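/- arXiv:1512.07219 — 2 statements merged into one kernel-verified Lean document; each statement's English description precedes it below -/
import Mathlib

section
/- Let $T>0$ and $H\in(\tfrac23,1)$. Then $\lim_{\varepsilon\to0^+}\varepsilon^{3-\frac2H}\cdot \frac1\pi\int_{\mathcal{S}} \big((\varepsilon+\Sigma_{11})(\varepsilon+\Sigma_{22})-\Sigma_{12}^2\big)^{-3/2}\,\Sigma_{12}\; ds_1\, ds_2\, dt_1\, dt_2 = \sigma^2$, where $\sigma^2 := \frac{T^{2H}(2H-1)}{4H\pi}\, B\big(\tfrac1H,\tfrac{3H-2}{2H}\big)^2\, B(2,2H-1)$. (This integral equals $\tfrac12\,\mathbb{E}[\alpha_\varepsilon^2]$, where $\alpha_\varepsilon=\int_0^T\int_0^t p'_\varepsilon(B_t-B_s)\,ds\,dt$ is the approximating derivative of self-intersection local time of fractional Brownian motion; thus $\varepsilon^{3-2/H}\,\mathbb{E}[\alpha_\varepsilon^2]\to\sigma^2$.) -/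
open Real Set MeasureTheory Filter

/-- The covariance `𝔼[B_{u₁}(B_{x+u₂} - B_x)]` of a fractional Brownian motion of
Hurst parameter `H`. -/
noncomputable def mu (H x u₁ u₂ : ℝ) : ℝ :=
  (1/2) * ((x + u₂) ^ (2*H) - x ^ (2*H) - |x + u₂ - u₁| ^ (2*H) + |x - u₁| ^ (2*H))

/-- The Euler Beta function `B(p,q) = ∫₀¹ x^{p-1}(1-x)^{q-1} dx`. -/
noncomputable def betaFn (p q : ℝ) : ℝ := ∫ x in (0:ℝ)..1, x ^ (p - 1) * (1 - x) ^ (q - 1)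

/-- The region `𝒮 = {(s₁,s₂,t₁,t₂) ∈ [0,T]⁴ : s₁ ≤ t₁, s₂ ≤ t₂, s₁ ≤ s₂}`. -/
def regS (T : ℝ) : Set (ℝ × ℝ × ℝ × ℝ) :=
  {p | p.1 ∈ Icc (0:ℝ) T ∧ p.2.1 ∈ Icc (0:ℝ) T ∧ p.2.2.1 ∈ Icc (0:ℝ) T ∧
    p.2.2.2 ∈ Icc (0:ℝ) T ∧ p.1 ≤ p.2.2.1 ∧ p.2.1 ≤ p.2.2.2 ∧ p.1 ≤ p.2.1}

/-- Half of the second moment `𝔼[α_ε²]` of the approximating derivative of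
self-intersection local time, written as the integral over `𝒮` of
`det(εI + Σ)^{-3/2} Σ₁₂ / π`. -/
noncomputable def halfMomentAlpha (H T ε : ℝ) : ℝ :=
  (1/π) * ∫ p in regS T,
    ((ε + (p.2.2.1 - p.1) ^ (2*H)) * (ε + (p.2.2.2 - p.2.1) ^ (2*H)) -
        mu H (p.2.1 - p.1) (p.2.2.1 - p.1) (p.2.2.2 - p.2.1) ^ 2) ^ (-(3/2 : ℝ)) *
      mu H (p.2.1 - p.1) (p.2.2.1 - p.1) (p.2.2.2 - p.2.1)

/-- The truncated power `(t - r)₊ ^ α`. -/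
noncomputable def truncPow (α t r : ℝ) : ℝ := (max (t - r) 0) ^ α

/-- The Mandelbrot–Van Ness kernel of the increment over `[s, t]`. -/
noncomputable def incKernel (α s t r : ℝ) : ℝ := truncPow α t r - truncPow α s r

lemma measurable_truncPow (α t : ℝ) : Measurable (truncPow α t) := by
  unfold truncPow; fun_prop

lemma measurable_incKernel (α s t : ℝ) : Measurable (incKernel α s t) :=
  (measurable_truncPow α t).sub (measurable_truncPow α s)

lemma truncPow_of_le {α t r : ℝ} (hα : 0 < α) (h : t ≤ r) : truncPow α t r = 0 := by
  unfold truncPow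
  rw [max_eq_right (by linarith), Real.zero_rpow hα.ne']

lemma integrable_incKernel_sq_unit {α : ℝ} (h0 : 0 < α) (h1 : α < 1 / 2) :
    Integrable (fun r => incKernel α 0 1 r ^ 2) := by
  have hsm : AEStronglyMeasurable (fun r => incKernel α 0 1 r ^ 2) :=
    ((measurable_incKernel α 0 1).pow_const 2).aestronglyMeasurable
  have hp : ∀ a b : ℝ, 0 ≤ a → a ≤ b → a ^ α ≤ b ^ α := fun a b ha hab =>
    Real.rpow_le_rpow ha hab h0.le
  -- pointwise bounds
  have hb1 : ∀ r, incKernel α 0 1 r ^ 2 ≤ 1 := by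
    intro r
    unfold incKernel truncPow
    have e1 : (max (0 - r) 0) ^ α ≤ (max (1 - r) 0) ^ α :=
      hp _ _ (le_max_right _ _) (max_le_max (by linarith) le_rfl)
    have e2 : (max (1 - r) 0) ^ α ≤ (max (0 - r) 0) ^ α + 1 := by
      calc (max (1 - r) 0) ^ α ≤ (max (0 - r) 0 + 1) ^ α := by
            apply hp _ _ (le_max_right _ _)
            apply max_le
            · linarith [le_max_left (0 - r) 0]
            · linarith [le_max_right (0 - r) 0]
        _ ≤ _ := by
            have := Real.rpow_add_le_add_rpow (le_max_right (0 - r) 0) zero_le_one h0.le (by linarith : α ≤ 1)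
            simpa using this
    nlinarith
  have hb2 : ∀ r, r < -1 → incKernel α 0 1 r ^ 2 ≤ (-r) ^ (2 * α - 2) := by
    intro r hr
    unfold incKernel truncPow
    rw [max_eq_left (by linarith), max_eq_left (by linarith)]
    have hr0 : 0 < -r := by linarith
    have e1 : (0 - r) ^ α ≤ (1 - r) ^ α := hp _ _ (by linarith) (by linarith)
    have e2 : (1 - r) ^ α ≤ (0 - r) ^ α + (-r) ^ (α - 1) := by
      have hb := rpow_one_add_le_one_add_mul_self (s := 1 / (-r)) (p := α)
        (by have : 0 < 1 / (-r) := by positivity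
            linarith) h0.le (by linarith)
      have : (1 - r) = (-r) * (1 + 1 / (-r)) := by
        rw [mul_add, mul_one_div_cancel hr0.ne']; ring
      rw [this, Real.mul_rpow hr0.le (by positivity), Real.rpow_sub hr0, Real.rpow_one, zero_sub]
      have hpos : 0 < (-r) ^ α := Real.rpow_pos_of_pos hr0 _
      calc (-r) ^ α * (1 + 1 / (-r)) ^ α ≤ (-r) ^ α * (1 + α * (1 / (-r))) := by gcongr
        _ ≤ (-r) ^ α * (1 + 1 * (1 / (-r))) := by gcongr; linarith
        _ = _ := by field_simp
    have e3 : (-r) ^ (2 * α - 2) = ((-r) ^ (α - 1)) ^ 2 := by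
      rw [← Real.rpow_natCast, ← Real.rpow_mul hr0.le]; congr 1; push_cast; ring
    rw [e3]
    apply pow_le_pow_left₀ <;> linarith
  have hI : IntegrableOn (fun r => incKernel α 0 1 r ^ 2) (Iio (-1)) := by
    have h := (integrableOn_Ioi_rpow_of_lt (a := 2 * α - 2) (by linarith) (c := 1) one_pos)
    have h' : IntegrableOn (fun r : ℝ => (-r) ^ (2 * α - 2)) (Iio (-1)) := by
      have := h.comp_neg
      simpa using this
    refine h'.mono' hsm.restrict ?_
    refine (ae_restrict_iff' measurableSet_Iio).2 (ae_of_all _ fun r hr => ?_)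
    rw [Real.norm_of_nonneg (sq_nonneg _)]
    exact hb2 r hr
  have hII : IntegrableOn (fun r => incKernel α 0 1 r ^ 2) (Icc (-1) 1) := by
    refine Measure.integrableOn_of_bounded (M := 1) (by simp) hsm ?_
    refine ae_of_all _ fun r => ?_
    rw [Real.norm_of_nonneg (sq_nonneg _)]
    exact hb1 r
  have hIII : IntegrableOn (fun r => incKernel α 0 1 r ^ 2) (Ioi 1) := by
    refine (integrableOn_zero).congr_fun (fun r hr => ?_) measurableSet_Ioi
    have hr' : (1:ℝ) < r := hr
    simp [incKernel, truncPow_of_le h0 hr'.le, truncPow_of_le h0 (zero_le_one.trans hr'.le)]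
  rw [← integrableOn_univ]
  refine ((hI.union hII).union hIII).mono_set fun r _ => ?_
  rcases lt_or_ge r (-1) with h | h
  · exact Or.inl (Or.inl h)
  · rcases le_or_gt r 1 with h' | h'
    · exact Or.inl (Or.inr ⟨h, h'⟩)
    · exact Or.inr h'

lemma incKernel_scale {α s t : ℝ} (h : s < t) (r : ℝ) :
    incKernel α s t r = (t - s) ^ α * incKernel α 0 1 ((r - s) / (t - s)) := by
  have hd : 0 < t - s := by linarith
  have key : ∀ w v : ℝ, (t - s) * v = w → (max w 0) ^ α = (t - s) ^ α * (max v 0) ^ α := by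
    intro w v hw
    rw [← Real.mul_rpow hd.le (le_max_right _ _), mul_max_of_nonneg _ _ hd.le, hw, mul_zero]
  unfold incKernel truncPow
  rw [mul_sub, ← key (t - r) _ (by field_simp; ring), ← key (s - r) _ (by field_simp; ring)]

lemma incKernel_sq_integral {α : ℝ} (h0 : 0 < α) (h1 : α < 1 / 2) (s t : ℝ) :
    Integrable (fun r => incKernel α s t r ^ 2) ∧
    ∫ r, incKernel α s t r ^ 2 = (∫ r, incKernel α 0 1 r ^ 2) * |t - s| ^ (2 * α + 1) := by
  have main : ∀ s t : ℝ, s < t → Integrable (fun r => incKernel α s t r ^ 2) ∧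
    ∫ r, incKernel α s t r ^ 2 = (∫ r, incKernel α 0 1 r ^ 2) * |t - s| ^ (2 * α + 1) := by
    intro s t h
    have hd : 0 < t - s := by linarith
    have e : (fun r => incKernel α s t r ^ 2) = fun r => ((t - s) ^ α) ^ 2 *
        (fun r => (fun r => incKernel α 0 1 r ^ 2) (r / (t - s))) (r - s) := by
      funext r; rw [incKernel_scale h, mul_pow]
    rw [e]
    constructor
    · exact (((integrable_incKernel_sq_unit h0 h1).comp_div hd.ne').comp_sub_right s).const_mul _
    · rw [integral_const_mul, integral_sub_right_eq_self
        (fun r => (fun r => incKernel α 0 1 r ^ 2) (r / (t - s))),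
        Measure.integral_comp_div (fun r => incKernel α 0 1 r ^ 2), abs_of_pos hd,
        smul_eq_mul, Real.rpow_add hd, Real.rpow_one, two_mul, Real.rpow_add hd]
      ring
  rcases lt_trichotomy s t with h | h | h
  · exact main s t h
  · subst h
    simp [incKernel, Real.zero_rpow (by linarith : 2 * α + 1 ≠ 0)]
  · have e : (fun r => incKernel α s t r ^ 2) = fun r => incKernel α t s r ^ 2 := by
      funext r; unfold incKernel; ring
    rw [e, abs_sub_comm]; exact main t s h

/-- A function which on `(s, t]` equals `v (t - r) ^ α` up to a remainder has a large `L²` norm. -/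
lemma window_bound {α : ℝ} (h0 : 0 < α) {s t v : ℝ} (hst : s ≤ t) {W R : ℝ → ℝ}
    (hW : Integrable (fun r => W r ^ 2)) (hR : Integrable (fun r => R r ^ 2))
    (h : ∀ r ∈ Ioc s t, v * (t - r) ^ α = W r - R r) :
    v ^ 2 * (t - s) ^ (2 * α + 1) ≤
      (2 * α + 1) * (2 * ∫ r, W r ^ 2) + (2 * α + 1) * (2 * ∫ r, R r ^ 2) := by
  have e1 : ∫ r in Ioc s t, v ^ 2 * (t - r) ^ (2 * α) =
      v ^ 2 * ((t - s) ^ (2 * α + 1) / (2 * α + 1)) := by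
    rw [integral_const_mul, ← intervalIntegral.integral_of_le hst,
      intervalIntegral.integral_comp_sub_left (fun x => x ^ (2 * α)),
      integral_rpow (Or.inl (by linarith)), sub_self, Real.zero_rpow (by linarith), sub_zero]
  have e2 : ∫ r in Ioc s t, v ^ 2 * (t - r) ^ (2 * α) ≤
      ∫ r in Ioc s t, (2 * W r ^ 2 + 2 * R r ^ 2) := by
    refine setIntegral_mono_on ?_ ((hW.const_mul 2).add (hR.const_mul 2)).integrableOn
      measurableSet_Ioc fun r hr => ?_
    · refine ((Continuous.integrableOn_Icc ?_).mono_set Ioc_subset_Icc_self)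
      refine continuous_const.mul (Continuous.rpow_const (by fun_prop) fun x => Or.inr (by linarith))
    · have hr' : 0 ≤ t - r := by linarith [hr.2]
      have : v ^ 2 * (t - r) ^ (2 * α) = (W r - R r) ^ 2 := by
        rw [← h r hr, mul_pow, ← Real.rpow_natCast ((t - r) ^ α), ← Real.rpow_mul hr']
        congr 2; push_cast; ring
      rw [this]; nlinarith [sq_nonneg (W r + R r)]
  have e3 : ∫ r in Ioc s t, (2 * W r ^ 2 + 2 * R r ^ 2) ≤ ∫ r, (2 * W r ^ 2 + 2 * R r ^ 2) :=
    setIntegral_le_integral ((hW.const_mul 2).add (hR.const_mul 2))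
      (ae_of_all _ fun r => by simp only [Pi.zero_apply]; positivity)
  rw [integral_add (hW.const_mul 2) (hR.const_mul 2), integral_const_mul, integral_const_mul] at e3
  rw [e1] at e2
  have hp : 0 < 2 * α + 1 := by linarith
  have e4 := mul_le_mul_of_nonneg_left (e2.trans e3) hp.le
  have e5 : (2 * α + 1) * (v ^ 2 * ((t - s) ^ (2 * α + 1) / (2 * α + 1))) =
    v ^ 2 * (t - s) ^ (2 * α + 1) := by field_simp
  rw [e5] at e4
  linarith

/-- The variance of `x I₁ + y I₂ + z I₃` for fractional Brownian increments `I₁, I₂, I₃` over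
consecutive intervals of lengths `a, b, c`. -/
noncomputable def incForm (H a b c x y z : ℝ) : ℝ :=
  x ^ 2 * a ^ (2 * H) + y ^ 2 * b ^ (2 * H) + z ^ 2 * c ^ (2 * H)
    + x * y * ((a + b) ^ (2 * H) - a ^ (2 * H) - b ^ (2 * H))
    + y * z * ((b + c) ^ (2 * H) - b ^ (2 * H) - c ^ (2 * H))
    + x * z * ((a + b + c) ^ (2 * H) + b ^ (2 * H) - (a + b) ^ (2 * H) - (b + c) ^ (2 * H))

/-- Local nondeterminism of fractional Brownian motion for three consecutive increments. -/
lemma local_nondeterminism {H : ℝ} (hH : H ∈ Ioo (1 / 2 : ℝ) 1) :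
    ∃ K : ℝ, 1 ≤ K ∧ ∀ a b c x y z : ℝ, 0 ≤ a → 0 ≤ b → 0 ≤ c →
      x ^ 2 * a ^ (2 * H) + y ^ 2 * b ^ (2 * H) + z ^ 2 * c ^ (2 * H) ≤
        K * incForm H a b c x y z := by
  obtain ⟨hH1, hH2⟩ := hH
  set α := H - 1 / 2 with hα
  have h0 : 0 < α := by linarith
  have h1 : α < 1 / 2 := by linarith
  have hH' : 2 * α + 1 = 2 * H := by rw [hα]; ring
  set κ := ∫ r, incKernel α 0 1 r ^ 2 with hκ
  have hκ0 : 0 ≤ κ := integral_nonneg fun r => sq_nonneg _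
  have hsq : ∀ s t, Integrable (fun r => incKernel α s t r ^ 2) ∧
      ∫ r, incKernel α s t r ^ 2 = κ * |t - s| ^ (2 * H) := by
    intro s t; have := incKernel_sq_integral h0 h1 s t; rwa [hH'] at this
  set P := 2 * H * 2 * κ with hP
  have hP0 : 0 ≤ P := by positivity
  refine ⟨1 + P + (2 * P + 1) * (P + P * P) + (2 * P + 1) * P, by
    have : 0 ≤ P + (2 * P + 1) * (P + P * P) + (2 * P + 1) * P := by positivity
    linarith, ?_⟩
  intro a b c x y z ha hb hc
  have hWexp : ∀ x y z : ℝ, (fun r => (x * incKernel α 0 a r + y * incKernel α a (a + b) r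
    + z * incKernel α (a + b) (a + b + c) r) ^ 2) = fun r =>
      (x ^ 2 - x * y) * incKernel α 0 a r ^ 2 + (y ^ 2 - x * y - y * z + x * z) * incKernel α a (a + b) r ^ 2
      + (z ^ 2 - y * z) * incKernel α (a + b) (a + b + c) r ^ 2
      + (x * y - x * z) * incKernel α 0 (a + b) r ^ 2
      + (y * z - x * z) * incKernel α a (a + b + c) r ^ 2
      + (x * z) * incKernel α 0 (a + b + c) r ^ 2 := by
    intro x y z; funext r; unfold incKernel; ring
  have hWint : ∀ x y z : ℝ, Integrable (fun r => (x * incKernel α 0 a r + y * incKernel α a (a + b) r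
    + z * incKernel α (a + b) (a + b + c) r) ^ 2) ∧ ∫ r, (x * incKernel α 0 a r + y * incKernel α a (a + b) r
    + z * incKernel α (a + b) (a + b + c) r) ^ 2 = κ * incForm H a b c x y z := by
    intro x y z
    rw [hWexp]
    have i1 := (hsq 0 a).1.const_mul (x ^ 2 - x * y)
    have i2 := (hsq a (a + b)).1.const_mul (y ^ 2 - x * y - y * z + x * z)
    have i3 := (hsq (a + b) (a + b + c)).1.const_mul (z ^ 2 - y * z)
    have i4 := (hsq 0 (a + b)).1.const_mul (x * y - x * z)
    have i5 := (hsq a (a + b + c)).1.const_mul (y * z - x * z)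
    have i6 := (hsq 0 (a + b + c)).1.const_mul (x * z)
    refine ⟨((((i1.fun_add i2).fun_add i3).fun_add i4).fun_add i5).fun_add i6, ?_⟩
    rw [integral_add ((((i1.fun_add i2).fun_add i3).fun_add i4).fun_add i5) i6,
      integral_add (((i1.fun_add i2).fun_add i3).fun_add i4) i5, integral_add ((i1.fun_add i2).fun_add i3) i4,
      integral_add (i1.fun_add i2) i3, integral_add i1 i2]
    simp only [integral_const_mul, (hsq _ _).2]
    rw [show a - 0 = a by ring, show a + b - a = b by ring, show a + b + c - (a + b) = c by ring,
      show a + b - 0 = a + b by ring, show a + b + c - a = b + c by ring,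
      show a + b + c - 0 = a + b + c by ring, abs_of_nonneg ha, abs_of_nonneg hb, abs_of_nonneg hc,
      abs_of_nonneg (add_nonneg ha hb), abs_of_nonneg (add_nonneg hb hc),
      abs_of_nonneg (add_nonneg (add_nonneg ha hb) hc)]
    unfold incForm; ring
  have tp : ∀ t r : ℝ, r ≤ t → truncPow α t r = (t - r) ^ α := by
    intro t r h; unfold truncPow; rw [max_eq_left (by linarith)]
  set Q := incForm H a b c x y z with hQ
  have w3 := window_bound h0 (s := a + b) (t := a + b + c) (v := z) (by linarith) (hWint x y z).1
    (R := fun _ => 0) (by simp) (by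
      intro r hr
      unfold incKernel
      rw [tp _ r hr.2, truncPow_of_le h0 (t := a + b) hr.1.le,
        truncPow_of_le h0 (t := a) (by linarith [hr.1]), truncPow_of_le h0 (t := 0) (by linarith [hr.1])]
      ring)
  have w2 := window_bound h0 (s := a) (t := a + b) (v := y) (by linarith) (hWint x y z).1
    (hWint 0 0 z).1 (by
      intro r hr
      unfold incKernel
      rw [tp _ r hr.2, truncPow_of_le h0 (t := a) hr.1.le, truncPow_of_le h0 (t := 0) (by linarith [hr.1])]
      ring)
  have w1 := window_bound h0 (s := 0) (t := a) (v := x) (by linarith) (hWint x y z).1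
    (hWint 0 y z).1 (by
      intro r hr
      unfold incKernel
      rw [tp _ r hr.2, truncPow_of_le h0 (t := 0) hr.1.le]
      ring)
  rw [(hWint x y z).2] at w1 w2 w3
  rw [(hWint 0 y z).2] at w1
  rw [(hWint 0 0 z).2] at w2
  have hyz : κ * incForm H a b c 0 y z ≤ κ * (2 * (y ^ 2 * b ^ (2 * H)) + 2 * (z ^ 2 * c ^ (2 * H))) := by
    have hm := (hWint 0 y (-z)).2
    have hm' : 0 ≤ κ * incForm H a b c 0 y (-z) := by rw [← hm]; exact integral_nonneg fun r => sq_nonneg _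
    have : incForm H a b c 0 y z + incForm H a b c 0 y (-z) = 2 * (y ^ 2 * b ^ (2 * H)) + 2 * (z ^ 2 * c ^ (2 * H)) := by
      unfold incForm; ring
    rw [← this, mul_add]; linarith
  have hz : incForm H a b c 0 0 z = z ^ 2 * c ^ (2 * H) := by unfold incForm; ring
  rw [hz] at w2
  simp only [ne_eq, OfNat.ofNat_ne_zero, not_false_eq_true, zero_pow, integral_zero] at w3
  rw [hH'] at w1 w2 w3
  rw [show a + b + c - (a + b) = c by ring] at w3
  rw [show a + b - a = b by ring] at w2
  rw [sub_zero] at w1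
  set A := x ^ 2 * a ^ (2 * H)
  set B := y ^ 2 * b ^ (2 * H)
  set C := z ^ 2 * c ^ (2 * H)
  have hC0 : 0 ≤ C := by positivity
  have hB0 : 0 ≤ B := by positivity
  have v3 : C ≤ P * Q := by rw [hP]; linarith
  have v2 : B ≤ P * Q + P * C := by rw [hP]; linarith
  have v1 : A ≤ P * Q + P * (2 * B + 2 * C) := by
    have := mul_le_mul_of_nonneg_left hyz (by positivity : 0 ≤ 2 * H * 2)
    rw [hP]; linarith
  have v2' : B ≤ (P + P * P) * Q := by
    have := mul_le_mul_of_nonneg_left v3 hP0; linarith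
  have hκ1 : 0 < κ := by
    have := window_bound h0 (s := 0) (t := 1) (v := 1) zero_le_one (hsq 0 1).1
      (R := fun _ => 0) (by simp) (by
        intro r hr
        unfold incKernel
        rw [tp _ r hr.2, truncPow_of_le h0 (t := 0) hr.1.le]
        ring)
    rw [← hκ] at this
    simp only [ne_eq, OfNat.ofNat_ne_zero, not_false_eq_true, zero_pow, integral_zero, sub_zero,
      Real.one_rpow] at this
    by_contra hneg
    rw [le_antisymm (not_lt.1 hneg) hκ0] at this
    norm_num at this
  have hQ0 : 0 ≤ Q := by
    have h2 := (hWint x y z).2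
    rw [← hQ] at h2
    exact nonneg_of_mul_nonneg_right (h2 ▸ integral_nonneg fun r => sq_nonneg _) hκ1
  have := mul_le_mul_of_nonneg_left v3 hP0
  have := mul_le_mul_of_nonneg_left v2' hP0
  linarith

/-- A quadratic form dominating a positive semidefinite one has larger discriminant. -/
lemma det_le_det_of_form_le {p r q p' r' q' : ℝ} (hp' : 0 < p') (hdet : 0 ≤ p' * q' - r' ^ 2)
    (h : ∀ l n : ℝ, p' * l ^ 2 + 2 * r' * l * n + q' * n ^ 2 ≤ p * l ^ 2 + 2 * r * l * n + q * n ^ 2) :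
    p' * q' - r' ^ 2 ≤ p * q - r ^ 2 := by
  have h1 : p' ≤ p := by have := h 1 0; norm_num at this; linarith
  have h2 := h r (-p)
  have hp : 0 < p := hp'.trans_le h1
  have h3 : p' * (p' * r ^ 2 + 2 * r' * r * (-p) + q' * (-p) ^ 2) =
    (p' * q' - r' ^ 2) * p ^ 2 + (p' * r - r' * p) ^ 2 := by ring
  have h4 : (p' * q' - r' ^ 2) * p ^ 2 ≤ p' * (p * (p * q - r ^ 2)) := by
    have := mul_le_mul_of_nonneg_left h2 hp'.le
    nlinarith [sq_nonneg (p' * r - r' * p)]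
  have h5 : (p' * q' - r' ^ 2) * p ≤ p' * (p * q - r ^ 2) := by
    refine le_of_mul_le_mul_right (?_ : _ * p ≤ _ * p) hp
    linarith
  have h6 : (p' * q' - r' ^ 2) * p' ≤ (p * q - r ^ 2) * p' := by
    have := mul_le_mul_of_nonneg_left h1 hdet
    linarith
  exact le_of_mul_le_mul_right h6 hp'

/-- The determinant of `I + Σ`, where `Σ` is the covariance matrix of two increments. -/
noncomputable def detOne (H x u₁ u₂ : ℝ) : ℝ :=
  (1 + u₁ ^ (2 * H)) * (1 + u₂ ^ (2 * H)) - mu H x u₁ u₂ ^ 2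

lemma mu_disjoint {H a b c : ℝ} (hb : 0 ≤ b) (hc : 0 ≤ c) :
    mu H (a + b) a c = (1 / 2) * ((a + b + c) ^ (2 * H) - (a + b) ^ (2 * H) - (b + c) ^ (2 * H)
      + b ^ (2 * H)) := by
  unfold mu
  rw [show a + b + c - a = b + c by ring, show a + b - a = b by ring, abs_of_nonneg hb,
    abs_of_nonneg (add_nonneg hb hc)]

lemma mu_overlap {H a b c : ℝ} (hb : 0 ≤ b) (hc : 0 ≤ c) :
    mu H a (a + b) (b + c) = (1 / 2) * ((a + b + c) ^ (2 * H) - a ^ (2 * H) - c ^ (2 * H)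
      + b ^ (2 * H)) := by
  unfold mu
  rw [show a + (b + c) - (a + b) = c by ring, show a - (a + b) = -b by ring, abs_neg,
    abs_of_nonneg hb, abs_of_nonneg hc, show a + (b + c) = a + b + c by ring]

lemma mu_nested {H a b c : ℝ} (hb : 0 ≤ b) (hc : 0 ≤ c) :
    mu H a (a + b + c) b = (1 / 2) * ((a + b) ^ (2 * H) - a ^ (2 * H) - c ^ (2 * H)
      + (b + c) ^ (2 * H)) := by
  unfold mu
  rw [show a + b - (a + b + c) = -c by ring, show a - (a + b + c) = -(b + c) by ring, abs_neg,
    abs_neg, abs_of_nonneg hc, abs_of_nonneg (add_nonneg hb hc)]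

lemma detOne_lower_bounds {H : ℝ} (hH : H ∈ Ioo (1 / 2 : ℝ) 1) :
    ∃ K : ℝ, 1 ≤ K ∧ ∀ a b c : ℝ, 0 ≤ a → 0 ≤ b → 0 ≤ c →
      (1 + a ^ (2 * H)) * (1 + c ^ (2 * H)) ≤ K * detOne H (a + b) a c ∧
      (1 + a ^ (2 * H)) * (1 + b ^ (2 * H) + c ^ (2 * H)) ≤ K * detOne H a (a + b) (b + c) ∧
      (1 + b ^ (2 * H)) * (1 + a ^ (2 * H) + c ^ (2 * H)) ≤ K * detOne H a (a + b) (b + c) ∧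
      (1 + b ^ (2 * H)) * (1 + a ^ (2 * H) + c ^ (2 * H)) ≤ K * detOne H a (a + b + c) b := by
  obtain ⟨K, hK, h⟩ := local_nondeterminism hH
  refine ⟨K ^ 2, by nlinarith, fun a b c ha hb hc => ?_⟩
  have hab := add_nonneg ha hb
  have hbc := add_nonneg hb hc
  have hA : 0 ≤ a ^ (2 * H) := by positivity
  have hB : 0 ≤ b ^ (2 * H) := by positivity
  have hC : 0 ≤ c ^ (2 * H) := by positivity
  have hAB := mul_nonneg hA hB
  have hAC := mul_nonneg hA hC
  have hBC := mul_nonneg hB hC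
  have key : ∀ {p r q p' r' q' : ℝ}, 0 ≤ p' → 0 ≤ q' → 0 ≤ p' * q' - r' ^ 2 →
      (∀ l n : ℝ, p' * l ^ 2 + 2 * r' * l * n + q' * n ^ 2 ≤ K * (p * l ^ 2 + 2 * r * l * n + q * n ^ 2)) →
      (1 + p') * (1 + q') - r' ^ 2 ≤ K ^ 2 * ((1 + p) * (1 + q) - r ^ 2) := by
    intro p r q p' r' q' hp' hq' hd hf
    have := det_le_det_of_form_le (p := K * (1 + p)) (r := K * r) (q := K * (1 + q))
      (p' := 1 + p') (r' := r') (q' := 1 + q') (by linarith) (by nlinarith) (fun l n => by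
        have e := hf l n
        nlinarith [mul_nonneg (sub_nonneg.2 hK) (sq_nonneg l), mul_nonneg (sub_nonneg.2 hK) (sq_nonneg n)])
    linarith
  have hd := key (p := a ^ (2 * H)) (r := mu H (a + b) a c) (q := c ^ (2 * H))
    (p' := a ^ (2 * H)) (r' := 0) (q' := c ^ (2 * H)) hA hC (by linarith) (fun l n => by
      have := h a b c l 0 n ha hb hc
      unfold incForm at this
      rw [mu_disjoint hb hc]
      convert this using 1 <;> ring)
  have ho := key (p := (a + b) ^ (2 * H)) (r := mu H a (a + b) (b + c)) (q := (b + c) ^ (2 * H))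
    (p' := a ^ (2 * H) + b ^ (2 * H)) (r' := b ^ (2 * H)) (q' := b ^ (2 * H) + c ^ (2 * H))
    (by positivity) (by positivity) (by nlinarith) (fun l n => by
      have := h a b c l (l + n) n ha hb hc
      unfold incForm at this
      rw [mu_overlap hb hc]
      convert this using 1 <;> ring)
  have hn := key (p := (a + b + c) ^ (2 * H)) (r := mu H a (a + b + c) b) (q := b ^ (2 * H))
    (p' := a ^ (2 * H) + b ^ (2 * H) + c ^ (2 * H)) (r' := b ^ (2 * H)) (q' := b ^ (2 * H))
    (by positivity) (by positivity) (by nlinarith) (fun l n => by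
      have := h a b c l (l + n) l ha hb hc
      unfold incForm at this
      rw [mu_nested hb hc]
      convert this using 1 <;> ring)
  unfold detOne
  refine ⟨by linarith, by linarith, by linarith, by linarith⟩

lemma mu_scale {H δ x u₁ u₂ : ℝ} (hδ : 0 ≤ δ) (hx : 0 ≤ x) (h2 : 0 ≤ u₂) :
    mu H (δ * x) (δ * u₁) (δ * u₂) = δ ^ (2 * H) * mu H x u₁ u₂ := by
  unfold mu
  rw [← mul_add, ← mul_sub, ← mul_sub, abs_mul, abs_mul, abs_of_nonneg hδ,
    Real.mul_rpow hδ (add_nonneg hx h2), Real.mul_rpow hδ hx, Real.mul_rpow hδ (abs_nonneg _),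
    Real.mul_rpow hδ (abs_nonneg _)]
  ring

lemma exists_rpow_sub_eq {p a b : ℝ} (hp : 0 < p) (ha : 0 < a) (hab : a ≤ b) :
    ∃ η ∈ Icc a b, b ^ p - a ^ p = p * η ^ (p - 1) * (b - a) := by
  rcases hab.eq_or_lt with rfl | h
  · exact ⟨a, ⟨le_rfl, le_rfl⟩, by ring⟩
  · obtain ⟨η, hη, e⟩ := exists_hasDerivAt_eq_slope (fun t => t ^ p) (fun t => p * t ^ (p - 1)) h
      (fun t ht => (Real.continuousAt_rpow_const _ _ (Or.inr hp.le)).continuousWithinAt)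
      (fun t ht => Real.hasDerivAt_rpow_const (Or.inl (ha.trans ht.1).ne'))
    refine ⟨η, Ioo_subset_Icc_self hη, ?_⟩
    rw [e, div_mul_cancel₀ _ (sub_pos.2 h).ne']

lemma abs_rpow_sub_le {p a b N : ℝ} (hp : 1 ≤ p) (ha : 0 ≤ a) (hb : 0 ≤ b) (haN : a ≤ N)
    (hbN : b ≤ N) : |b ^ p - a ^ p| ≤ p * N ^ (p - 1) * |b - a| := by
  have := Convex.norm_image_sub_le_of_norm_hasDerivWithin_le (f := fun t : ℝ => t ^ p)
    (f' := fun t => p * t ^ (p - 1)) (s := Icc 0 N) (x := a) (y := b) (C := p * N ^ (p - 1))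
    (fun t ht => (Real.hasDerivAt_rpow_const (Or.inr hp)).hasDerivWithinAt)
    (fun t ht => by
      have h0 : 0 ≤ t ^ (p - 1) := Real.rpow_nonneg ht.1 _
      rw [Real.norm_of_nonneg (by positivity)]
      exact mul_le_mul_of_nonneg_left (Real.rpow_le_rpow ht.1 ht.2 (by linarith)) (by linarith))
    (convex_Icc 0 N) ⟨ha, haN⟩ ⟨hb, hbN⟩
  simpa only [Real.norm_eq_abs] using this

lemma abs_mu_le {H x u₁ u₂ N : ℝ} (hH : 1 / 2 < H) (hx : 0 ≤ x) (h1 : 0 ≤ u₁) (h2 : 0 ≤ u₂)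
    (hN1 : u₁ ≤ N) (hN2 : x + u₂ ≤ N) :
    |mu H x u₁ u₂| ≤ 2 * H * N ^ (2 * H - 1) * u₁ ∧ |mu H x u₁ u₂| ≤ 2 * H * N ^ (2 * H - 1) * u₂ := by
  have hp : 1 ≤ 2 * H := by linarith
  have hN : 0 ≤ N := h1.trans hN1
  have e1 : |x + u₂ - u₁| ≤ N := abs_le.2 ⟨by linarith, by linarith⟩
  have e2 : |x - u₁| ≤ N := abs_le.2 ⟨by linarith, by linarith⟩
  have hC : 0 ≤ 2 * H * N ^ (2 * H - 1) := by positivity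
  have bd : ∀ {p q w : ℝ}, 0 ≤ p → 0 ≤ q → p ≤ N → q ≤ N → |p - q| ≤ w →
      |p ^ (2 * H) - q ^ (2 * H)| ≤ 2 * H * N ^ (2 * H - 1) * w := fun hp0 hq0 hpN hqN hw =>
    (abs_rpow_sub_le hp hq0 hp0 hqN hpN).trans (mul_le_mul_of_nonneg_left hw hC)
  have dd : ∀ {p q w : ℝ}, |p - q| ≤ w → |(|p| - |q|)| ≤ w := fun h => (abs_abs_sub_abs_le_abs_sub _ _).trans h
  constructor
  · have f1 := bd (p := x + u₂) (q := |x + u₂ - u₁|) (w := u₁) (by linarith) (abs_nonneg _) hN2 e1 (by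
      have := dd (p := x + u₂) (q := x + u₂ - u₁) (w := u₁) (by simp [abs_of_nonneg h1])
      rwa [abs_of_nonneg (add_nonneg hx h2)] at this)
    have f2 := bd (p := x) (q := |x - u₁|) (w := u₁) hx (abs_nonneg _) (by linarith) e2 (by
      have := dd (p := x) (q := x - u₁) (w := u₁) (by simp [abs_of_nonneg h1])
      rwa [abs_of_nonneg hx] at this)
    unfold mu
    rw [abs_le] at f1 f2 ⊢
    constructor <;> linarith
  · have f1 := bd (p := x + u₂) (q := x) (w := u₂) (by linarith) hx hN2 (by linarith) (by simp [abs_of_nonneg h2])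
    have f2 := bd (p := |x + u₂ - u₁|) (q := |x - u₁|) (w := u₂) (abs_nonneg _) (abs_nonneg _) e1 e2
      (dd (by rw [show x + u₂ - u₁ - (x - u₁) = u₂ by ring, abs_of_nonneg h2]))
    unfold mu
    rw [abs_le] at f1 f2 ⊢
    constructor <;> linarith

/-- Mean value formula for the covariance of separated increments. -/
lemma exists_mu_eq {H x u₁ u₂ : ℝ} (hH : 1 / 2 < H) (hx : 0 < x) (h1 : 0 ≤ u₁) (h2 : 0 ≤ u₂)
    (h : 2 * u₁ ≤ x) :
    ∃ η ∈ Icc (x - u₁) (x + u₂), mu H x u₁ u₂ = H * (2 * H - 1) * u₁ * u₂ * η ^ (2 * H - 2) := by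
  have hxu : 0 < x - u₁ := by linarith
  have hF : ∃ ξ ∈ Icc x (x + u₂), ((x + u₂) ^ (2 * H) - (x + u₂ - u₁) ^ (2 * H)) - (x ^ (2 * H) - (x - u₁) ^ (2 * H))
      = 2 * H * (ξ ^ (2 * H - 1) - (ξ - u₁) ^ (2 * H - 1)) * u₂ := by
    rcases h2.eq_or_lt with rfl | h2
    · exact ⟨x, ⟨le_rfl, by simp⟩, by simp⟩
    · have hd : ∀ t, x ≤ t → HasDerivAt (fun t => t ^ (2 * H) - (t - u₁) ^ (2 * H))
          (2 * H * t ^ (2 * H - 1) - 2 * H * (t - u₁) ^ (2 * H - 1)) t := fun t ht => by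
        refine (Real.hasDerivAt_rpow_const (Or.inl (by linarith))).sub ?_
        have := ((hasDerivAt_id t).sub_const u₁).rpow_const (p := 2 * H) (Or.inl (by simp only [id]; linarith))
        simpa using this
      obtain ⟨ξ, hξ, e⟩ := exists_hasDerivAt_eq_slope _ _ (lt_add_of_pos_right x h2)
        (fun t ht => (hd t ht.1).continuousAt.continuousWithinAt) (fun t ht => hd t ht.1.le)
      refine ⟨ξ, Ioo_subset_Icc_self hξ, ?_⟩
      rw [mul_sub, e, add_sub_cancel_left, div_mul_cancel₀ _ h2.ne']
  obtain ⟨ξ, hξ, e⟩ := hF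
  obtain ⟨η, hη, e'⟩ := exists_rpow_sub_eq (p := 2 * H - 1) (a := ξ - u₁) (b := ξ) (by linarith)
    (by linarith [hξ.1]) (by linarith)
  refine ⟨η, ⟨by linarith [hη.1, hξ.1], by linarith [hη.2, hξ.2]⟩, ?_⟩
  unfold mu
  rw [abs_of_pos hxu, abs_of_pos (by linarith : 0 < x + u₂ - u₁)]
  rw [e', show 2 * H - 1 - 1 = 2 * H - 2 by ring] at e
  linarith

lemma one_add_rpow_neg_le {q p t : ℝ} (hq : 0 ≤ q) (hp : 0 ≤ p) :
    (1 + |t| ^ q) ^ (-p) ≤ 2 ^ (q * p) * (1 + ‖t‖) ^ (-(q * p)) := by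
  have ht := abs_nonneg t
  have h1 : (1 + |t|) ^ q ≤ 2 ^ q * (1 + |t| ^ q) := by
    calc (1 + |t|) ^ q ≤ (2 * max 1 |t|) ^ q := by
          apply Real.rpow_le_rpow (by positivity) _ hq
          linarith [le_max_left 1 |t|, le_max_right 1 |t|]
      _ = 2 ^ q * (max 1 |t|) ^ q := Real.mul_rpow (by norm_num) (by positivity)
      _ ≤ _ := by
          gcongr
          have : 0 ≤ |t| ^ q := by positivity
          rcases max_choice 1 |t| with h | h <;> rw [h]
          · rw [Real.one_rpow]; linarith
          · linarith
  have h2 : (1 + |t|) ^ (q * p) ≤ 2 ^ (q * p) * (1 + |t| ^ q) ^ p := by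
    rw [Real.rpow_mul (by positivity), Real.rpow_mul (by norm_num), ← Real.mul_rpow (by positivity) (by positivity)]
    exact Real.rpow_le_rpow (by positivity) h1 hp
  rw [Real.norm_eq_abs, Real.rpow_neg (by positivity), Real.rpow_neg (by positivity),
    ← div_eq_mul_inv, inv_eq_one_div, div_le_div_iff₀ (by positivity) (by positivity), one_mul]
  exact h2

/-- The profile `|t| (1 + |t|^{2H})^{-3/2}`. -/
noncomputable def profileOne (H t : ℝ) : ℝ := |t| * (1 + |t| ^ (2 * H)) ^ (-(3 / 2 : ℝ))

/-- The profile `(1 + |t|^{2H})^{-3/4}`. -/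
noncomputable def profileHalf (H t : ℝ) : ℝ := (1 + |t| ^ (2 * H)) ^ (-(3 / 4 : ℝ))

lemma profileOne_nonneg (H t : ℝ) : 0 ≤ profileOne H t := by unfold profileOne; positivity

lemma profileHalf_nonneg (H t : ℝ) : 0 ≤ profileHalf H t := by unfold profileHalf; positivity

lemma integrable_profileOne {H : ℝ} (hH : 2 / 3 < H) : Integrable (profileOne H) := by
  have h := (integrable_one_add_norm (E := ℝ) (μ := volume) (r := 2 * H * (3 / 2) - 1)
    (by simp; linarith)).const_mul (2 ^ (2 * H * (3 / 2)))
  refine h.mono' (Measurable.aestronglyMeasurable (by unfold profileOne; fun_prop))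
    (ae_of_all _ fun t => ?_)
  rw [Real.norm_of_nonneg (profileOne_nonneg H t)]
  have h1 := one_add_rpow_neg_le (q := 2 * H) (p := 3 / 2) (t := t) (by linarith) (by norm_num)
  unfold profileOne
  calc |t| * (1 + |t| ^ (2 * H)) ^ (-(3 / 2 : ℝ))
      ≤ (1 + ‖t‖) * (2 ^ (2 * H * (3 / 2)) * (1 + ‖t‖) ^ (-(2 * H * (3 / 2)))) := by
        apply mul_le_mul _ h1 (by positivity) (by positivity)
        rw [Real.norm_eq_abs]; linarith
    _ = _ := by
        rw [show -(2 * H * (3 / 2) - 1) = -(2 * H * (3 / 2)) + 1 by ring,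
          Real.rpow_add_one (by positivity)]
        ring

lemma integrable_profileHalf {H : ℝ} (hH : 2 / 3 < H) : Integrable (profileHalf H) := by
  have h := (integrable_one_add_norm (E := ℝ) (μ := volume) (r := 2 * H * (3 / 4))
    (by simp; linarith)).const_mul (2 ^ (2 * H * (3 / 4)))
  refine h.mono' (Measurable.aestronglyMeasurable (by unfold profileHalf; fun_prop))
    (ae_of_all _ fun t => ?_)
  rw [Real.norm_of_nonneg (profileHalf_nonneg H t)]
  exact one_add_rpow_neg_le (q := 2 * H) (p := 3 / 4) (t := t) (by linarith) (by norm_num)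

lemma integral_profileOne {H : ℝ} (hH : 0 < H) :
    ∫ t in Ioi 0, profileOne H t = 1 / (2 * H) * betaFn (1 / H) ((3 * H - 2) / (2 * H)) := by
  let f : ℝ → ℝ := fun v => 1 - (1 + v ^ (2 * H))⁻¹
  let f' : ℝ → ℝ := fun v => (2 * H * v ^ (2 * H - 1)) / (1 + v ^ (2 * H)) ^ 2
  have hpos : ∀ v : ℝ, 0 < v → 0 < v ^ (2 * H) := fun v hv => Real.rpow_pos_of_pos hv _
  have hf : ∀ v ∈ Ioi (0 : ℝ), HasDerivWithinAt f (f' v) (Ioi 0) v := by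
    intro v hv
    have hv0 : 0 < v := hv
    have := hpos v hv
    have h1 : HasDerivAt (fun v : ℝ => 1 + v ^ (2 * H)) (2 * H * v ^ (2 * H - 1)) v :=
      (Real.hasDerivAt_rpow_const (Or.inl hv0.ne')).const_add 1
    have h2 := (h1.fun_inv (by positivity)).const_sub 1
    refine h2.hasDerivWithinAt.congr_deriv ?_
    simp only [f']; ring
  have hinj : InjOn f (Ioi 0) := by
    intro a ha b hb hab
    simp only [f, sub_right_inj, inv_inj, add_right_inj] at hab
    exact (Real.rpow_left_inj (le_of_lt ha) (le_of_lt hb) (by positivity)).1 hab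
  have himg : f '' Ioi 0 = Ioo 0 1 := by
    ext x
    constructor
    · rintro ⟨v, hv, rfl⟩
      have := hpos v hv
      have h3 : (1 + v ^ (2 * H))⁻¹ < 1 := inv_lt_one_of_one_lt₀ (by linarith)
      have h4 : 0 < (1 + v ^ (2 * H))⁻¹ := by positivity
      exact ⟨by simp only [f]; linarith, by simp only [f]; linarith⟩
    · rintro ⟨hx0, hx1⟩
      have h5 : 0 < 1 - x := by linarith
      refine ⟨(x / (1 - x)) ^ (1 / (2 * H)), Real.rpow_pos_of_pos (by positivity) _, ?_⟩
      simp only [f]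
      rw [← Real.rpow_mul (by positivity), one_div_mul_cancel (by positivity), Real.rpow_one]
      field_simp
      ring
  unfold betaFn
  rw [intervalIntegral.integral_of_le zero_le_one, integral_Ioc_eq_integral_Ioo, ← himg,
    integral_image_eq_integral_abs_deriv_smul measurableSet_Ioi hf hinj, ← integral_const_mul]
  refine setIntegral_congr_fun measurableSet_Ioi fun v hv => ?_
  have hv0 : 0 < v := hv
  have hV := hpos v hv
  have hV1 : 0 < 1 + v ^ (2 * H) := by positivity
  have hf' : 0 ≤ f' v := by simp only [f']; positivity
  have e1 : f v = v ^ (2 * H) / (1 + v ^ (2 * H)) := by simp only [f]; field_simp; ring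
  have e2 : 1 - f v = (1 + v ^ (2 * H))⁻¹ := by simp only [f]; ring
  simp only [smul_eq_mul]
  rw [abs_of_nonneg hf', e2, e1, Real.div_rpow hV.le hV1.le, Real.inv_rpow hV1.le,
    ← Real.rpow_neg hV1.le, ← Real.rpow_mul hv0.le, div_eq_mul_inv (v ^ (2 * H * (1 / H - 1))),
    ← Real.rpow_neg hV1.le (1 / H - 1)]
  simp only [f', profileOne]
  rw [abs_of_pos hv0, ← Real.rpow_natCast, div_eq_mul_inv (2 * H * v ^ (2 * H - 1)),
    ← Real.rpow_neg hV1.le ((2 : ℕ) : ℝ)]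
  have e3 : (1 + v ^ (2 * H)) ^ (-(3 / 2 : ℝ)) = (1 + v ^ (2 * H)) ^ (-((2 : ℕ) : ℝ)) *
      (1 + v ^ (2 * H)) ^ (-(1 / H - 1)) * (1 + v ^ (2 * H)) ^ (-((3 * H - 2) / (2 * H) - 1)) := by
    rw [← Real.rpow_add hV1, ← Real.rpow_add hV1]
    congr 1; push_cast; field_simp; ring
  have e4 : v = v ^ (2 * H - 1) * v ^ (2 * H * (1 / H - 1)) := by
    rw [← Real.rpow_add hv0]
    conv_lhs => rw [← Real.rpow_one v]
    congr 1; field_simp; ring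
  rw [e3]
  nth_rewrite 1 [e4]
  field_simp

lemma betaFn_two {H : ℝ} (hH : 1 / 2 < H) : betaFn 2 (2 * H - 1) = 1 / (2 * H * (2 * H - 1)) := by
  unfold betaFn
  have e : ∀ x ∈ Ioc (0 : ℝ) 1, (1 - x) ^ ((2:ℝ) - 1) * x ^ (2 * H - 1 - 1) =
      x ^ (2 * H - 2) - x ^ (2 * H - 1) := by
    intro x hx
    have : x ^ (2 * H - 1) = x ^ (2 * H - 2) * x := by
      rw [← Real.rpow_add_one hx.1.ne']; congr 1; ring
    rw [this, show (2:ℝ) - 1 = 1 by norm_num, Real.rpow_one, show 2 * H - 1 - 1 = 2 * H - 2 by ring]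
    ring
  have h1 := intervalIntegral.integral_comp_sub_left (a := 0) (b := 1)
    (fun x : ℝ => (1 - x) ^ ((2:ℝ) - 1) * x ^ (2 * H - 1 - 1)) 1
  simp only [sub_sub_cancel, sub_self, sub_zero] at h1
  rw [h1, intervalIntegral.integral_of_le zero_le_one, setIntegral_congr_fun measurableSet_Ioc e,
    ← intervalIntegral.integral_of_le zero_le_one, intervalIntegral.integral_sub
      (intervalIntegral.intervalIntegrable_rpow' (by linarith))
      (intervalIntegral.intervalIntegrable_rpow' (by linarith)),
    integral_rpow (Or.inl (by linarith)), integral_rpow (Or.inl (by linarith))]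
  have a1 : 2 * H - 2 + 1 ≠ 0 := by linarith
  have a2 : 2 * H - 1 + 1 ≠ 0 := by linarith
  have a3 : 2 * H - 1 ≠ 0 := by linarith
  have a4 : H ≠ 0 := by linarith
  rw [Real.zero_rpow a1, Real.zero_rpow a2, Real.one_rpow, Real.one_rpow]
  rw [show 2 * H - 2 + 1 = 2 * H - 1 by ring, show 2 * H - 1 + 1 = 2 * H by ring]
  field_simp
  ring

/-- The linear parametrisation of the increments `[s, s + d₂ v₁]`, `[s + d₁ y, s + d₁ y + d₂ v₂]`. -/
def paramMap (d₁ d₂ : ℝ) (p : ℝ × ℝ × ℝ × ℝ) : ℝ × ℝ × ℝ × ℝ :=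
  (p.1, p.1 + d₁ * p.2.1, p.1 + d₂ * p.2.2.1, p.1 + d₁ * p.2.1 + d₂ * p.2.2.2)

lemma measurable_paramMap (d₁ d₂ : ℝ) : Measurable (paramMap d₁ d₂) := by
  unfold paramMap; fun_prop

lemma lintegral_eq_lintegral_affine {d : ℝ} (hd : 0 < d) (a : ℝ) {f : ℝ → ENNReal}
    (hf : Measurable f) : ∫⁻ u, f u = ENNReal.ofReal d * ∫⁻ v, f (a + d * v) := by
  have h := Real.smul_map_volume_mul_left hd.ne'
  rw [abs_of_pos hd] at h
  calc ∫⁻ u, f u = ∫⁻ u, f (a + u) := (lintegral_add_left_eq_self f a).symm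
    _ = ∫⁻ u, f (a + u) ∂(ENNReal.ofReal d • Measure.map (d * ·) volume) := by rw [h]
    _ = _ := by
      rw [lintegral_smul_measure, lintegral_map (by fun_prop) (by fun_prop), smul_eq_mul]

lemma volume_eq_smul_map_paramMap {d₁ d₂ : ℝ} (h₁ : 0 < d₁) (h₂ : 0 < d₂) :
    (volume : Measure (ℝ × ℝ × ℝ × ℝ)) =
      ENNReal.ofReal (d₁ * d₂ ^ 2) • Measure.map (paramMap d₁ d₂) volume := by
  refine Measure.ext_of_lintegral _ fun F hF => ?_
  have iter : ∀ G : ℝ × ℝ × ℝ × ℝ → ENNReal, Measurable G →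
      ∫⁻ p, G p = ∫⁻ a, ∫⁻ b, ∫⁻ c, ∫⁻ d, G (a, b, c, d) := by
    intro G hG
    rw [Measure.volume_eq_prod, lintegral_prod _ hG.aemeasurable]
    refine lintegral_congr fun a => ?_
    rw [Measure.volume_eq_prod, lintegral_prod _ (by fun_prop)]
    refine lintegral_congr fun b => ?_
    rw [Measure.volume_eq_prod, lintegral_prod _ (by fun_prop)]
  have hF' : Measurable fun p : ℝ × ℝ × ℝ × ℝ => F (paramMap d₁ d₂ p) := hF.comp (measurable_paramMap d₁ d₂)
  rw [lintegral_smul_measure, lintegral_map hF (measurable_paramMap _ _), iter F hF,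
    iter _ hF']
  have m3 : ∀ G : ℝ × ℝ × ℝ × ℝ → ENNReal, Measurable G → ∀ a b, Measurable fun c => ∫⁻ d, G (a, b, c, d) :=
    fun G hG a b => Measurable.lintegral_prod_right' (f := fun p : ℝ × ℝ => G (a, b, p.1, p.2)) (by fun_prop)
  have m2 : ∀ G : ℝ × ℝ × ℝ × ℝ → ENNReal, Measurable G → ∀ a, Measurable fun b => ∫⁻ c, ∫⁻ d, G (a, b, c, d) :=
    fun G hG a => Measurable.lintegral_prod_right' (f := fun p : ℝ × ℝ => ∫⁻ d, G (a, p.1, p.2, d))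
      (Measurable.lintegral_prod_right' (f := fun p : (ℝ × ℝ) × ℝ => G (a, p.1.1, p.1.2, p.2)) (by fun_prop))
  have m1 : ∀ G : ℝ × ℝ × ℝ × ℝ → ENNReal, Measurable G → Measurable fun a => ∫⁻ b, ∫⁻ c, ∫⁻ d, G (a, b, c, d) :=
    fun G hG => Measurable.lintegral_prod_right' (f := fun p : ℝ × ℝ => ∫⁻ c, ∫⁻ d, G (p.1, p.2, c, d))
      (Measurable.lintegral_prod_right' (f := fun p : (ℝ × ℝ) × ℝ => ∫⁻ d, G (p.1.1, p.1.2, p.2, d))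
        (Measurable.lintegral_prod_right' (f := fun p : ((ℝ × ℝ) × ℝ) × ℝ => G (p.1.1.1, p.1.1.2, p.1.2, p.2)) (by fun_prop)))
  have hc : ENNReal.ofReal (d₁ * d₂ ^ 2) = ENNReal.ofReal d₁ * (ENNReal.ofReal d₂ * ENNReal.ofReal d₂) := by
    rw [← ENNReal.ofReal_mul h₂.le, ← ENNReal.ofReal_mul h₁.le, sq]
  rw [smul_eq_mul, hc, ← lintegral_const_mul _ (m1 _ hF')]
  refine lintegral_congr fun a => ?_
  rw [lintegral_eq_lintegral_affine h₁ a (m2 F hF a), mul_assoc, ← lintegral_const_mul _ (m2 _ hF' a)]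
  congr 1
  refine lintegral_congr fun b => ?_
  rw [lintegral_eq_lintegral_affine h₂ a (m3 F hF a _), mul_assoc, ← lintegral_const_mul _ (m3 _ hF' a b)]
  congr 1
  refine lintegral_congr fun c => ?_
  rw [lintegral_eq_lintegral_affine h₂ (a + d₁ * b) (by fun_prop)]
  rfl

lemma integral_eq_integral_paramMap {d₁ d₂ : ℝ} (h₁ : 0 < d₁) (h₂ : 0 < d₂)
    {f : ℝ × ℝ × ℝ × ℝ → ℝ} (hf : Measurable f) :
    ∫ p, f p = d₁ * d₂ ^ 2 * ∫ p, f (paramMap d₁ d₂ p) := by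
  conv_lhs => rw [volume_eq_smul_map_paramMap h₁ h₂]
  rw [integral_smul_measure, integral_map (measurable_paramMap _ _).aemeasurable
    hf.aestronglyMeasurable, ENNReal.toReal_ofReal (by positivity), smul_eq_mul]

lemma Integrable.of_comp_paramMap {d₁ d₂ : ℝ} (h₁ : 0 < d₁) (h₂ : 0 < d₂)
    {f : ℝ × ℝ × ℝ × ℝ → ℝ} (hf : Measurable f) (h : Integrable fun p => f (paramMap d₁ d₂ p)) :
    Integrable f := by
  rw [volume_eq_smul_map_paramMap h₁ h₂]
  refine Integrable.smul_measure ?_ ENNReal.ofReal_ne_top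
  exact (integrable_map_measure hf.aestronglyMeasurable (measurable_paramMap _ _).aemeasurable).2 h

lemma Integrable.comp_linearEquiv {E : Type*} [NormedAddCommGroup E] [NormedSpace ℝ E]
    [FiniteDimensional ℝ E] [MeasurableSpace E] [BorelSpace E] {μ : Measure E} [μ.IsAddHaarMeasure]
    {f : E → ℝ} (hf : Integrable f μ) (L : E ≃ₗ[ℝ] E) : Integrable (fun p => f (L p)) μ := by
  have hm : Measure.map L μ = ENNReal.ofReal |(LinearMap.det (L : E →ₗ[ℝ] E))⁻¹| • μ :=
    Measure.map_linearMap_addHaar_eq_smul_addHaar μ (LinearEquiv.isUnit_det' L).ne_zero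
  have hi : Integrable f (Measure.map L μ) := by
    rw [hm]; exact hf.smul_measure ENNReal.ofReal_ne_top
  exact hi.comp_aemeasurable (L : E →ₗ[ℝ] E).continuous_of_finiteDimensional.aemeasurable

lemma rpow_neg_le_of_mul_le {K D X Y Z : ℝ} (hK : 1 ≤ K) (hX : 0 ≤ X) (hY : 0 ≤ Y) (hZ : 0 ≤ Z)
    (h : (1 + X) * (1 + Y + Z) ≤ K * D) :
    0 < D ∧ D ^ (-(3 / 2 : ℝ)) ≤ K ^ (3 / 2 : ℝ) *
      ((1 + X) ^ (-(3 / 2 : ℝ)) * ((1 + Y) ^ (-(3 / 4 : ℝ)) * (1 + Z) ^ (-(3 / 4 : ℝ)))) := by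
  have hK0 : 0 < K := by linarith
  have hD : 0 < D := by
    have : 0 < K * D := lt_of_lt_of_le (by positivity) h
    exact (mul_pos_iff_of_pos_left hK0).1 this
  refine ⟨hD, ?_⟩
  have h1 : (K * D) ^ (-(3 / 2 : ℝ)) ≤ ((1 + X) * (1 + Y + Z)) ^ (-(3 / 2 : ℝ)) :=
    Real.rpow_le_rpow_of_nonpos (by positivity) h (by norm_num)
  have h2 : (1 + Y + Z) ^ (-(3 / 2 : ℝ)) ≤ (1 + Y) ^ (-(3 / 4 : ℝ)) * (1 + Z) ^ (-(3 / 4 : ℝ)) := by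
    have e : (1 + Y + Z) ^ (-(3 / 2 : ℝ)) = (1 + Y + Z) ^ (-(3 / 4 : ℝ)) * (1 + Y + Z) ^ (-(3 / 4 : ℝ)) := by
      rw [← Real.rpow_add (by positivity)]; norm_num
    rw [e]
    apply mul_le_mul _ _ (by positivity) (by positivity)
    · exact Real.rpow_le_rpow_of_nonpos (by positivity) (by linarith) (by norm_num)
    · exact Real.rpow_le_rpow_of_nonpos (by positivity) (by linarith) (by norm_num)
  rw [Real.mul_rpow hK0.le hD.le, Real.mul_rpow (by positivity) (by positivity)] at h1
  have h3 : K ^ (3 / 2 : ℝ) * K ^ (-(3 / 2 : ℝ)) = 1 := by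
    rw [← Real.rpow_add hK0]; norm_num
  calc D ^ (-(3 / 2 : ℝ)) = K ^ (3 / 2 : ℝ) * (K ^ (-(3 / 2 : ℝ)) * D ^ (-(3 / 2 : ℝ))) := by
        rw [← mul_assoc, h3, one_mul]
    _ ≤ K ^ (3 / 2 : ℝ) * ((1 + X) ^ (-(3 / 2 : ℝ)) * (1 + Y + Z) ^ (-(3 / 2 : ℝ))) := by gcongr
    _ ≤ _ := by gcongr

/-- An integrable function of three variables. -/
noncomputable def profileProd (H : ℝ) (p : ℝ × ℝ × ℝ) : ℝ :=
  profileOne H p.1 * (profileHalf H p.2.1 * profileHalf H p.2.2)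

/-- An integrable majorant for the region where the increments are not well separated. -/
noncomputable def nearMajorant (H : ℝ) (p : ℝ × ℝ × ℝ) : ℝ :=
  profileProd H (p.2.2, p.2.1, p.1 - p.2.1) + profileProd H (p.1, p.2.1 - p.1, p.1 + p.2.2 - p.2.1) +
    profileProd H (p.2.1 - p.1, p.1, p.1 + p.2.2 - p.2.1) +
    profileProd H (p.2.2, p.1, p.2.1 - p.1 - p.2.2)

lemma profileProd_nonneg (H : ℝ) (p : ℝ × ℝ × ℝ) : 0 ≤ profileProd H p :=
  mul_nonneg (profileOne_nonneg _ _) (mul_nonneg (profileHalf_nonneg _ _) (profileHalf_nonneg _ _))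

lemma nearMajorant_nonneg (H : ℝ) (p : ℝ × ℝ × ℝ) : 0 ≤ nearMajorant H p := by
  unfold nearMajorant
  have := profileProd_nonneg H
  have h1 := this (p.2.2, p.2.1, p.1 - p.2.1)
  have h2 := this (p.1, p.2.1 - p.1, p.1 + p.2.2 - p.2.1)
  have h3 := this (p.2.1 - p.1, p.1, p.1 + p.2.2 - p.2.1)
  have h4 := this (p.2.2, p.1, p.2.1 - p.1 - p.2.2)
  linarith

/-- A linear automorphism of `ℝ³` given by mutually inverse formulas. -/
def linearEquivOfInverse (f g : ℝ × ℝ × ℝ → ℝ × ℝ × ℝ) (ha : ∀ p q, f (p + q) = f p + f q)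
    (hs : ∀ (c : ℝ) p, f (c • p) = c • f p) (h1 : ∀ p, g (f p) = p) (h2 : ∀ p, f (g p) = p) :
    (ℝ × ℝ × ℝ) ≃ₗ[ℝ] (ℝ × ℝ × ℝ) where
  toFun := f
  invFun := g
  map_add' := ha
  map_smul' := hs
  left_inv := h1
  right_inv := h2

lemma integrable_nearMajorant {H : ℝ} (hH : 2 / 3 < H) : Integrable (nearMajorant H) := by
  have : (volume : Measure (ℝ × ℝ)).IsAddHaarMeasure :=
    inferInstanceAs ((volume : Measure ℝ).prod volume).IsAddHaarMeasure
  have : (volume : Measure (ℝ × ℝ × ℝ)).IsAddHaarMeasure :=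
    inferInstanceAs ((volume : Measure ℝ).prod (volume : Measure (ℝ × ℝ))).IsAddHaarMeasure
  have hP : Integrable (profileProd H) :=
    (integrable_profileOne hH).mul_prod ((integrable_profileHalf hH).mul_prod (integrable_profileHalf hH))
  have i1 := Integrable.comp_linearEquiv hP (linearEquivOfInverse
    (fun p => (p.2.2, p.2.1, p.1 - p.2.1)) (fun p => (p.2.1 + p.2.2, p.2.1, p.1))
    (by intro p q; ext <;> (simp <;> try ring)) (by intro c p; ext <;> (simp <;> try ring))
    (by intro p; ext <;> simp) (by intro p; ext <;> simp))
  have i2 := Integrable.comp_linearEquiv hP (linearEquivOfInverse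
    (fun p => (p.1, p.2.1 - p.1, p.1 + p.2.2 - p.2.1)) (fun p => (p.1, p.1 + p.2.1, p.2.1 + p.2.2))
    (by intro p q; ext <;> (simp <;> try ring)) (by intro c p; ext <;> (simp <;> try ring))
    (by intro p; ext <;> simp) (by intro p; ext <;> simp))
  have i3 := Integrable.comp_linearEquiv hP (linearEquivOfInverse
    (fun p => (p.2.1 - p.1, p.1, p.1 + p.2.2 - p.2.1)) (fun p => (p.2.1, p.1 + p.2.1, p.1 + p.2.2))
    (by intro p q; ext <;> (simp <;> try ring)) (by intro c p; ext <;> (simp <;> try ring))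
    (by intro p; ext <;> simp) (by intro p; ext <;> (simp <;> try ring)))
  have i4 := Integrable.comp_linearEquiv hP (linearEquivOfInverse
    (fun p => (p.2.2, p.1, p.2.1 - p.1 - p.2.2)) (fun p => (p.2.1, p.1 + p.2.1 + p.2.2, p.1))
    (by intro p q; ext <;> (simp <;> try ring)) (by intro c p; ext <;> (simp <;> try ring))
    (by intro p; ext <;> (simp <;> try ring)) (by intro p; ext <;> (simp <;> try ring)))
  exact ((i1.add i2).add i3).add i4

lemma detOne_bounds {H : ℝ} (hH : H ∈ Ioo (1 / 2 : ℝ) 1) :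
    ∃ C : ℝ, 0 ≤ C ∧ ∀ y v w : ℝ, 0 ≤ y → 0 ≤ v → 0 ≤ w → 0 < detOne H y v w ∧
      (v ≤ y → detOne H y v w ^ (-(3 / 2 : ℝ)) ≤
        C * ((1 + v ^ (2 * H)) ^ (-(3 / 2 : ℝ)) * (1 + w ^ (2 * H)) ^ (-(3 / 2 : ℝ)))) ∧
      (y ≤ 2 * v → ∀ N, v ≤ N → y + w ≤ N →
        |detOne H y v w ^ (-(3 / 2 : ℝ)) * mu H y v w| ≤
          C * (2 * H * N ^ (2 * H - 1)) * nearMajorant H (y, v, w)) := by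
  obtain ⟨K, hK, h⟩ := detOne_lower_bounds hH
  obtain ⟨hH1, hH2⟩ := hH
  have hK0 : 0 < K := by linarith
  set C := (2 * K) ^ (3 / 2 : ℝ) with hC
  have hKC : K ^ (3 / 2 : ℝ) ≤ C := Real.rpow_le_rpow hK0.le (by linarith) (by norm_num)
  have hC0 : 0 ≤ C := by positivity
  refine ⟨C, hC0, fun y v w hy hv hw => ?_⟩
  have pn := profileProd_nonneg H
  have pe : ∀ a b c : ℝ, 0 ≤ a → 0 ≤ b → 0 ≤ c → profileProd H (a, b, c) =
      ((1 + a ^ (2 * H)) ^ (-(3 / 2 : ℝ)) * ((1 + b ^ (2 * H)) ^ (-(3 / 4 : ℝ)) *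
        (1 + c ^ (2 * H)) ^ (-(3 / 4 : ℝ)))) * a := by
    intro a b c ha hb hc
    unfold profileProd profileOne profileHalf
    simp only [abs_of_nonneg ha, abs_of_nonneg hb, abs_of_nonneg hc]
    ring
  have q1 := pn (w, v, y - v)
  have q2 := pn (y, v - y, y + w - v)
  have q3 := pn (v - y, y, y + w - v)
  have q4 := pn (w, y, v - y - w)
  -- the general shape of the estimate
  have est : ∀ {E m N : ℝ}, 0 ≤ N → 0 ≤ m → 0 ≤ detOne H y v w ^ (-(3 / 2 : ℝ)) →
      detOne H y v w ^ (-(3 / 2 : ℝ)) * m ≤ C * E → E ≤ nearMajorant H (y, v, w) →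
      |mu H y v w| ≤ 2 * H * N ^ (2 * H - 1) * m →
      |detOne H y v w ^ (-(3 / 2 : ℝ)) * mu H y v w| ≤
          C * (2 * H * N ^ (2 * H - 1)) * nearMajorant H (y, v, w) := by
    intro E m N hN hm hD hE hEM hmu
    rw [abs_mul, abs_of_nonneg hD]
    have hn : 0 ≤ 2 * H * N ^ (2 * H - 1) := by positivity
    calc _ ≤ detOne H y v w ^ (-(3 / 2 : ℝ)) * (2 * H * N ^ (2 * H - 1) * m) := by gcongr
      _ = 2 * H * N ^ (2 * H - 1) * (detOne H y v w ^ (-(3 / 2 : ℝ)) * m) := by ring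
      _ ≤ 2 * H * N ^ (2 * H - 1) * (C * nearMajorant H (y, v, w)) :=
          mul_le_mul_of_nonneg_left (hE.trans (mul_le_mul_of_nonneg_left hEM hC0)) hn
      _ = _ := by ring
  rcases le_or_gt v y with hvy | hlt
  · -- disjoint intervals
    obtain ⟨hd, -, -, -⟩ := h v (y - v) w hv (by linarith) hw
    rw [show v + (y - v) = y by ring] at hd
    have hv' : 0 ≤ v ^ (2 * H) := by positivity
    have hw' : 0 ≤ w ^ (2 * H) := by positivity
    obtain ⟨hD, hle⟩ := rpow_neg_le_of_mul_le (X := w ^ (2 * H)) (Y := v ^ (2 * H)) (Z := 0) hK hw' hv'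
      le_rfl (by linarith)
    have hD0 : 0 ≤ detOne H y v w ^ (-(3 / 2 : ℝ)) := by positivity
    refine ⟨hD, fun _ => ?_, fun hy2 N hN1 hN2 => ?_⟩
    · have h1 : (K * detOne H y v w) ^ (-(3 / 2 : ℝ)) ≤ ((1 + v ^ (2 * H)) * (1 + w ^ (2 * H))) ^ (-(3 / 2 : ℝ)) :=
        Real.rpow_le_rpow_of_nonpos (by positivity) hd (by norm_num)
      rw [Real.mul_rpow hK0.le hD.le, Real.mul_rpow (by positivity) (by positivity)] at h1
      have h3 : K ^ (3 / 2 : ℝ) * K ^ (-(3 / 2 : ℝ)) = 1 := by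
        rw [← Real.rpow_add hK0]; norm_num
      calc detOne H y v w ^ (-(3 / 2 : ℝ)) = K ^ (3 / 2 : ℝ) * (K ^ (-(3 / 2 : ℝ)) * detOne H y v w ^ (-(3 / 2 : ℝ))) := by
            rw [← mul_assoc, h3, one_mul]
        _ ≤ C * _ := mul_le_mul hKC h1 (by positivity) hC0
    · have hb : (y - v) ^ (2 * H) ≤ v ^ (2 * H) := Real.rpow_le_rpow (by linarith) (by linarith) (by linarith)
      have hb0 : 0 ≤ (y - v) ^ (2 * H) := Real.rpow_nonneg (by linarith) _
      obtain ⟨-, hle⟩ := rpow_neg_le_of_mul_le (K := 2 * K) (D := detOne H y v w)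
        (X := w ^ (2 * H)) (Y := v ^ (2 * H)) (Z := (y - v) ^ (2 * H)) (by linarith) hw' hv' hb0 (by nlinarith)
      refine est (E := profileProd H (w, v, y - v)) (m := w) (hv.trans hN1) hw hD0 ?_ ?_ (abs_mu_le hH1 hy hv hw hN1 hN2).2
      · rw [pe _ _ _ hw hv (by linarith), ← mul_assoc]
        gcongr
      · unfold nearMajorant; dsimp only; linarith
  have hvy : y ≤ v := hlt.le
  rcases le_total v (y + w) with hvw | hvw
  · -- overlapping intervals
    obtain ⟨-, ho1, ho2, -⟩ := h y (v - y) (y + w - v) hy (by linarith) (by linarith)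
    rw [show y + (v - y) = v by ring, show v - y + (y + w - v) = w by ring] at ho1 ho2
    have hy0 : 0 ≤ y ^ (2 * H) := by positivity
    have hb0 : 0 ≤ (v - y) ^ (2 * H) := Real.rpow_nonneg (by linarith) _
    have hc0 : 0 ≤ (y + w - v) ^ (2 * H) := Real.rpow_nonneg (by linarith) _
    obtain ⟨hD, hle1⟩ := rpow_neg_le_of_mul_le hK hy0 hb0 hc0 ho1
    obtain ⟨-, hle2⟩ := rpow_neg_le_of_mul_le hK hb0 hy0 hc0 ho2
    have hD0 : 0 ≤ detOne H y v w ^ (-(3 / 2 : ℝ)) := by positivity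
    refine ⟨hD, fun h' => absurd h' (not_le.2 hlt), fun hy2 N hN1 hN2 => ?_⟩
    · refine est (E := profileProd H (y, v - y, y + w - v) + profileProd H (v - y, y, y + w - v)) (m := v)
        (hv.trans hN1) hv hD0 ?_ ?_ (abs_mu_le hH1 hy hv hw hN1 hN2).1
      · rw [pe _ _ _ hy (by linarith) (by linarith), pe _ _ _ (by linarith) hy (by linarith)]
        have g1 := mul_le_mul_of_nonneg_right (hle1.trans (mul_le_mul_of_nonneg_right hKC (by positivity))) hy
        have g2 := mul_le_mul_of_nonneg_right (hle2.trans (mul_le_mul_of_nonneg_right hKC (by positivity))) (sub_nonneg.2 hvy)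
        linarith
      · unfold nearMajorant; dsimp only; linarith
  · -- nested intervals
    obtain ⟨-, -, -, hn⟩ := h y w (v - y - w) hy hw (by linarith)
    rw [show y + w + (v - y - w) = v by ring] at hn
    have hy0 : 0 ≤ y ^ (2 * H) := by positivity
    have hb0 : 0 ≤ w ^ (2 * H) := by positivity
    have hc0 : 0 ≤ (v - y - w) ^ (2 * H) := Real.rpow_nonneg (by linarith) _
    obtain ⟨hD, hle1⟩ := rpow_neg_le_of_mul_le hK hb0 hy0 hc0 hn
    have hD0 : 0 ≤ detOne H y v w ^ (-(3 / 2 : ℝ)) := by positivity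
    refine ⟨hD, fun h' => absurd h' (not_le.2 hlt), fun hy2 N hN1 hN2 => ?_⟩
    · refine est (E := profileProd H (w, y, v - y - w)) (m := w)
        (hv.trans hN1) hw hD0 ?_ ?_ (abs_mu_le hH1 hy hv hw hN1 hN2).2
      · rw [pe _ _ _ hw hy (by linarith), ← mul_assoc]
        exact mul_le_mul_of_nonneg_right (hle1.trans (mul_le_mul_of_nonneg_right hKC (by positivity))) hw
      · unfold nearMajorant; dsimp only; linarith

/-- If `c δ · d₁ δ · (d₂ δ)² · F δ ∘ paramMap (d₁ δ) (d₂ δ)` converges dominatedly to `L`, then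
`c δ · ∫ F δ` converges to `∫ L`. -/
lemma tendsto_integral_of_paramMap {F : ℝ → ℝ × ℝ × ℝ × ℝ → ℝ} {L Bd : ℝ × ℝ × ℝ × ℝ → ℝ}
    {c d₁ d₂ : ℝ → ℝ} (hc : ∀ δ, 0 < δ → 0 < c δ) (h₁ : ∀ δ, 0 < δ → 0 < d₁ δ)
    (h₂ : ∀ δ, 0 < δ → 0 < d₂ δ) (hF : ∀ δ, Measurable (F δ)) (hBd : Integrable Bd)
    (hle : ∀ δ, 0 < δ → ∀ p, |c δ * (d₁ δ * d₂ δ ^ 2) * F δ (paramMap (d₁ δ) (d₂ δ) p)| ≤ Bd p)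
    (hlim : ∀ p, Tendsto (fun δ => c δ * (d₁ δ * d₂ δ ^ 2) * F δ (paramMap (d₁ δ) (d₂ δ) p))
      (nhdsWithin 0 (Ioi 0)) (nhds (L p))) :
    Tendsto (fun δ => c δ * ∫ p, F δ p) (nhdsWithin 0 (Ioi 0)) (nhds (∫ p, L p)) ∧
      ∀ δ, 0 < δ → Integrable (F δ) := by
  have hmeas : ∀ δ, Measurable
      fun p => c δ * (d₁ δ * d₂ δ ^ 2) * F δ (paramMap (d₁ δ) (d₂ δ) p) := fun δ =>
    ((hF δ).comp (measurable_paramMap _ _)).const_mul _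
  constructor
  · have key := tendsto_integral_filter_of_dominated_convergence Bd
      (Eventually.of_forall fun δ => (hmeas δ).aestronglyMeasurable)
      (by
        filter_upwards [self_mem_nhdsWithin] with δ hδ
        exact Eventually.of_forall fun p => hle δ hδ p)
      hBd (Eventually.of_forall hlim)
    refine key.congr' ?_
    filter_upwards [self_mem_nhdsWithin] with δ hδ
    rw [integral_const_mul, integral_eq_integral_paramMap (h₁ δ hδ) (h₂ δ hδ) (hF δ)]
    ring
  · intro δ hδ
    refine Integrable.of_comp_paramMap (h₁ δ hδ) (h₂ δ hδ) (hF δ) ?_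
    have hk : c δ * (d₁ δ * d₂ δ ^ 2) ≠ 0 := by
      have := hc δ hδ
      have := h₁ δ hδ
      have := h₂ δ hδ
      positivity
    refine (integrable_const_mul_iff (isUnit_iff_ne_zero.2 hk) _).1 ?_
    exact hBd.mono' (hmeas δ).aestronglyMeasurable (Eventually.of_forall (hle δ hδ))

/-- The integrand of `halfMomentAlpha`. -/
noncomputable def momentIntegrand (H ε : ℝ) (p : ℝ × ℝ × ℝ × ℝ) : ℝ :=
  ((ε + (p.2.2.1 - p.1) ^ (2*H)) * (ε + (p.2.2.2 - p.2.1) ^ (2*H)) -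
        mu H (p.2.1 - p.1) (p.2.2.1 - p.1) (p.2.2.2 - p.2.1) ^ 2) ^ (-(3/2 : ℝ)) *
      mu H (p.2.1 - p.1) (p.2.2.1 - p.1) (p.2.2.2 - p.2.1)

lemma measurable_momentIntegrand (H ε : ℝ) : Measurable (momentIntegrand H ε) := by
  unfold momentIntegrand mu
  fun_prop

/-- The part of `regS T` where the increments are well separated. -/
def regFar (T : ℝ) : Set (ℝ × ℝ × ℝ × ℝ) :=
  regS T ∩ {p | p.1 < p.2.1 ∧ 2 * (p.2.2.1 - p.1) ≤ p.2.1 - p.1}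

lemma measurableSet_regS (T : ℝ) : MeasurableSet (regS T) := by
  unfold regS
  simp only [mem_Icc, measurableSet_setOfPred]
  measurability

lemma measurableSet_regFar (T : ℝ) : MeasurableSet (regFar T) := by
  refine (measurableSet_regS T).inter ?_
  have h1 : MeasurableSet {p : ℝ × ℝ × ℝ × ℝ | p.1 < p.2.1} :=
    measurableSet_lt (by fun_prop) (by fun_prop)
  have h2 : MeasurableSet {p : ℝ × ℝ × ℝ × ℝ | 2 * (p.2.2.1 - p.1) ≤ p.2.1 - p.1} :=
    measurableSet_le (by fun_prop) (by fun_prop)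
  exact h1.inter h2

lemma paramMap_mem_regS {T d₁ d₂ : ℝ} (h₁ : 0 < d₁) (h₂ : 0 < d₂) {s x v w : ℝ} :
    paramMap d₁ d₂ (s, x, v, w) ∈ regS T ↔
      0 ≤ s ∧ 0 ≤ x ∧ 0 ≤ v ∧ 0 ≤ w ∧ s + d₂ * v ≤ T ∧ s + d₁ * x + d₂ * w ≤ T := by
  have e₁ : 0 ≤ d₁ * x ↔ 0 ≤ x := mul_nonneg_iff_of_pos_left h₁
  have e₂ : 0 ≤ d₂ * v ↔ 0 ≤ v := mul_nonneg_iff_of_pos_left h₂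
  have e₃ : 0 ≤ d₂ * w ↔ 0 ≤ w := mul_nonneg_iff_of_pos_left h₂
  simp only [regS, paramMap, mem_ofPred_eq, mem_Icc]
  rw [← e₁, ← e₂, ← e₃]
  constructor
  · rintro ⟨⟨a1, a2⟩, ⟨a3, a4⟩, ⟨a5, a6⟩, ⟨a7, a8⟩, a9, a10, a11⟩
    refine ⟨?_, ?_, ?_, ?_, ?_, ?_⟩ <;> linarith
  · rintro ⟨a1, a2, a3, a4, a5, a6⟩
    refine ⟨⟨?_, ?_⟩, ⟨?_, ?_⟩, ⟨?_, ?_⟩, ⟨?_, ?_⟩, ?_, ?_, ?_⟩ <;> linarith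

lemma paramMap_mem_regFar {T δ : ℝ} (hδ : 0 < δ) {s x v w : ℝ} :
    paramMap 1 δ (s, x, v, w) ∈ regFar T ↔
      0 ≤ s ∧ 0 < x ∧ 0 ≤ v ∧ 0 ≤ w ∧ s + x + δ * w ≤ T ∧ 2 * (δ * v) ≤ x := by
  have e₃ : 0 ≤ w → 0 ≤ δ * w := mul_nonneg hδ.le
  rw [regFar, mem_inter_iff, paramMap_mem_regS one_pos hδ]
  simp only [paramMap, mem_ofPred_eq]
  constructor
  · rintro ⟨⟨a1, a2, a3, a4, a5, a6⟩, a7, a8⟩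
    refine ⟨a1, ?_, a3, a4, ?_, ?_⟩ <;> linarith
  · rintro ⟨a1, a2, a3, a4, a5, a6⟩
    have := e₃ a4
    refine ⟨⟨a1, a2.le, a3, a4, ?_, ?_⟩, ?_, ?_⟩ <;> linarith

lemma momentIntegrand_paramMap {H δ s y v w : ℝ} (hδ : 0 < δ) (hy : 0 ≤ y) (hv : 0 ≤ v)
    (hw : 0 ≤ w) (hD : 0 < detOne H y v w) :
    momentIntegrand H (δ ^ (2 * H)) (paramMap δ δ (s, y, v, w)) =
      δ ^ (-(4 * H)) * (detOne H y v w ^ (-(3 / 2 : ℝ)) * mu H y v w) := by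
  have e1 : s + δ * v - s = δ * v := by ring
  have e2 : s + δ * y - s = δ * y := by ring
  have e3 : s + δ * y + δ * w - (s + δ * y) = δ * w := by ring
  simp only [momentIntegrand, paramMap, e1, e2, e3]
  rw [mu_scale hδ.le hy hw, Real.mul_rpow hδ.le hv, Real.mul_rpow hδ.le hw]
  have hb : (δ ^ (2 * H) + δ ^ (2 * H) * v ^ (2 * H)) * (δ ^ (2 * H) + δ ^ (2 * H) * w ^ (2 * H)) -
      (δ ^ (2 * H) * mu H y v w) ^ 2 = δ ^ (4 * H) * detOne H y v w := by
    rw [show 4 * H = 2 * H + 2 * H by ring, Real.rpow_add hδ]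
    unfold detOne
    ring
  rw [hb, Real.mul_rpow (by positivity) hD.le, ← Real.rpow_mul hδ.le,
    show -(4 * H) = 4 * H * -(3 / 2 : ℝ) + 2 * H by ring, Real.rpow_add hδ]
  ring

lemma tendsto_near {H T : ℝ} (hT : 0 < T) (hH : H ∈ Ioo (2 / 3 : ℝ) 1) :
    Tendsto (fun δ : ℝ => δ ^ (6 * H - 4) *
        ∫ p, (regS T \ regFar T).indicator (momentIntegrand H (δ ^ (2 * H))) p)
      (nhdsWithin 0 (Ioi 0)) (nhds 0) ∧
    ∀ δ, 0 < δ → Integrable ((regS T \ regFar T).indicator (momentIntegrand H (δ ^ (2 * H)))) := by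
  obtain ⟨hH1, hH2⟩ := hH
  obtain ⟨C, hC0, hC⟩ := detOne_bounds (H := H) ⟨by linarith, hH2⟩
  set F : ℝ → ℝ × ℝ × ℝ × ℝ → ℝ := fun δ =>
    (regS T \ regFar T).indicator (momentIntegrand H (δ ^ (2 * H))) with hF
  -- membership in the region gives the constraints, and the value scales
  have hval : ∀ δ, 0 < δ → ∀ s y v w, paramMap δ δ (s, y, v, w) ∈ regS T \ regFar T →
      0 ≤ s ∧ s ≤ T ∧ 0 ≤ y ∧ 0 ≤ v ∧ 0 ≤ w ∧ y ≤ 2 * v ∧ v ≤ T / δ ∧ y + w ≤ T / δ := by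
    rintro δ hδ s y v w ⟨h1, h2⟩
    have h1' := h1
    rw [paramMap_mem_regS hδ hδ] at h1'
    obtain ⟨a1, a2, a3, a4, a5, a6⟩ := h1'
    have := mul_nonneg hδ.le a3
    refine ⟨a1, by linarith, a2, a3, a4, ?_, ?_, ?_⟩
    · by_contra! hlt
      refine h2 ⟨h1, ?_⟩
      have hy : 0 < y := by linarith
      have := mul_pos hδ hy
      have := mul_lt_mul_of_pos_left hlt hδ
      simp only [paramMap, mem_ofPred_eq]
      constructor <;> linarith
    · rw [le_div_iff₀ hδ]; linarith
    · rw [le_div_iff₀ hδ]; linarith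
  have hG : ∀ δ, 0 < δ → ∀ s y v w, paramMap δ δ (s, y, v, w) ∈ regS T \ regFar T →
      δ ^ (6 * H - 4) * (δ * δ ^ 2) * F δ (paramMap δ δ (s, y, v, w)) =
        δ ^ (2 * H - 1) * (detOne H y v w ^ (-(3 / 2 : ℝ)) * mu H y v w) := by
    intro δ hδ s y v w hmem
    obtain ⟨-, -, hy, hv, hw, -⟩ := hval δ hδ s y v w hmem
    simp only [hF]
    rw [indicator_of_mem hmem, momentIntegrand_paramMap hδ hy hv hw (hC y v w hy hv hw).1]
    have e : δ ^ (6 * H - 4) * (δ * δ ^ 2) * δ ^ (-(4 * H)) = δ ^ (2 * H - 1) := by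
      rw [show δ * δ ^ 2 = δ ^ (3 : ℝ) by norm_cast; ring, ← Real.rpow_add hδ, ← Real.rpow_add hδ]
      ring_nf
    rw [← e]
    ring
  have h0 : ∀ δ p, paramMap δ δ p ∉ regS T \ regFar T →
      δ ^ (6 * H - 4) * (δ * δ ^ 2) * F δ (paramMap δ δ p) = 0 := by
    intro δ p hp
    simp only [hF]
    rw [indicator_of_notMem hp, mul_zero]
  set K : ℝ := C * (2 * H * T ^ (2 * H - 1)) with hK
  have hK0 : 0 ≤ K := by positivity
  set Bd : ℝ × ℝ × ℝ × ℝ → ℝ := fun p =>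
    (Icc (0 : ℝ) T).indicator (fun _ => K) p.1 * nearMajorant H p.2 with hBd
  have hBdint : Integrable Bd := by
    refine Integrable.mul_prod (f := (Icc (0 : ℝ) T).indicator (fun _ => K)) ?_
      (integrable_nearMajorant hH1)
    rw [integrable_indicator_iff measurableSet_Icc]
    exact integrableOn_const (by simp)
  have hBd0 : ∀ p, 0 ≤ Bd p := fun p =>
    mul_nonneg (indicator_nonneg (fun _ _ => hK0) _) (nearMajorant_nonneg _ _)
  have key := tendsto_integral_of_paramMap (F := F) (L := fun _ => 0) (Bd := Bd)
    (c := fun δ => δ ^ (6 * H - 4)) (d₁ := fun δ => δ) (d₂ := fun δ => δ)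
    (fun δ hδ => by positivity) (fun δ hδ => hδ) (fun δ hδ => hδ)
    (fun δ => (measurable_momentIntegrand _ _).indicator
      ((measurableSet_regS T).diff (measurableSet_regFar T))) hBdint ?_ ?_
  · simpa using key
  · rintro δ hδ ⟨s, y, v, w⟩
    by_cases hmem : paramMap δ δ (s, y, v, w) ∈ regS T \ regFar T
    · obtain ⟨hs, hsT, hy, hv, hw, hyv, hvT, hywT⟩ := hval δ hδ s y v w hmem
      rw [hG δ hδ s y v w hmem, abs_mul, abs_of_nonneg (by positivity : 0 ≤ δ ^ (2 * H - 1))]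
      have := (hC y v w hy hv hw).2.2 hyv (T / δ) hvT hywT
      have e : δ ^ (2 * H - 1) * (T / δ) ^ (2 * H - 1) = T ^ (2 * H - 1) := by
        rw [← Real.mul_rpow hδ.le (by positivity), mul_div_cancel₀ _ hδ.ne']
      simp only [hBd]
      rw [indicator_of_mem (show s ∈ Icc (0 : ℝ) T from ⟨hs, hsT⟩)]
      calc _ ≤ δ ^ (2 * H - 1) * (C * (2 * H * (T / δ) ^ (2 * H - 1)) * nearMajorant H (y, v, w)) :=
            mul_le_mul_of_nonneg_left this (by positivity)
        _ = C * (2 * H * (δ ^ (2 * H - 1) * (T / δ) ^ (2 * H - 1))) * nearMajorant H (y, v, w) := by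
            ring
        _ = _ := by rw [e]
    · rw [h0 δ _ hmem, abs_zero]
      exact hBd0 _
  · rintro ⟨s, y, v, w⟩
    have hz : Tendsto (fun δ : ℝ => δ ^ (2 * H - 1) *
        |detOne H y v w ^ (-(3 / 2 : ℝ)) * mu H y v w|) (nhdsWithin 0 (Ioi 0)) (nhds 0) := by
      have : Tendsto (fun δ : ℝ => δ ^ (2 * H - 1)) (nhdsWithin 0 (Ioi 0)) (nhds 0) := by
        have h := (Real.continuousAt_rpow_const 0 (2 * H - 1) (Or.inr (by linarith))).tendsto
        rw [Real.zero_rpow (by linarith)] at h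
        exact h.mono_left nhdsWithin_le_nhds
      simpa using this.mul_const |detOne H y v w ^ (-(3 / 2 : ℝ)) * mu H y v w|
    refine squeeze_zero_norm' ?_ hz
    filter_upwards [self_mem_nhdsWithin] with δ hδ
    have hδ : 0 < δ := hδ
    by_cases hmem : paramMap δ δ (s, y, v, w) ∈ regS T \ regFar T
    · rw [hG δ hδ s y v w hmem, norm_mul, Real.norm_eq_abs, Real.norm_eq_abs,
        abs_of_nonneg (by positivity : 0 ≤ δ ^ (2 * H - 1))]
    · rw [h0 δ _ hmem, norm_zero]
      positivity

/-- The limit of the rescaled integrand in the region where the increments are well separated. -/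
noncomputable def farLimit (H T : ℝ) (p : ℝ × ℝ × ℝ × ℝ) : ℝ :=
  {q : ℝ × ℝ | 0 ≤ q.1 ∧ 0 < q.2 ∧ q.1 + q.2 < T}.indicator
      (fun q => H * (2 * H - 1) * q.2 ^ (2 * H - 2)) (p.1, p.2.1) *
    ((Ioi (0 : ℝ)).indicator (profileOne H) p.2.2.1 * (Ioi (0 : ℝ)).indicator (profileOne H) p.2.2.2)

lemma measurable_profileOne (H : ℝ) : Measurable (profileOne H) := by
  unfold profileOne
  fun_prop

lemma measurable_farLimit (H T : ℝ) : Measurable (farLimit H T) := by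
  unfold farLimit
  have h1 : MeasurableSet {q : ℝ × ℝ | 0 ≤ q.1 ∧ 0 < q.2 ∧ q.1 + q.2 < T} := by
    have h1 : MeasurableSet {q : ℝ × ℝ | 0 ≤ q.1} := measurableSet_le (by fun_prop) (by fun_prop)
    have h2 : MeasurableSet {q : ℝ × ℝ | 0 < q.2} := measurableSet_lt (by fun_prop) (by fun_prop)
    have h3 : MeasurableSet {q : ℝ × ℝ | q.1 + q.2 < T} :=
      measurableSet_lt (by fun_prop) (by fun_prop)
    exact h1.inter (h2.inter h3)
  have h2 : Measurable ({q : ℝ × ℝ | 0 ≤ q.1 ∧ 0 < q.2 ∧ q.1 + q.2 < T}.indicator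
      (fun q => H * (2 * H - 1) * q.2 ^ (2 * H - 2))) := Measurable.indicator (by fun_prop) h1
  have h3 : Measurable ((Ioi (0 : ℝ)).indicator (profileOne H)) :=
    (measurable_profileOne H).indicator measurableSet_Ioi
  exact (h2.comp (by fun_prop)).mul ((h3.comp (by fun_prop)).mul (h3.comp (by fun_prop)))

/-- A majorant for the region where the increments are well separated. -/
noncomputable def farMajorant (H T K : ℝ) (p : ℝ × ℝ × ℝ × ℝ) : ℝ :=
  (Icc (0 : ℝ) T).indicator (fun _ => K) p.1 *
    ((Ioc (0 : ℝ) T).indicator (fun x => x ^ (2 * H - 2)) p.2.1 *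
      (profileOne H p.2.2.1 * profileOne H p.2.2.2))

lemma farMajorant_nonneg {H T K : ℝ} (hK : 0 ≤ K) (p : ℝ × ℝ × ℝ × ℝ) : 0 ≤ farMajorant H T K p :=
  mul_nonneg (indicator_nonneg (fun _ _ => hK) _)
    (mul_nonneg (indicator_nonneg (fun _ hx => Real.rpow_nonneg hx.1.le _) _)
      (mul_nonneg (profileOne_nonneg _ _) (profileOne_nonneg _ _)))

lemma integrable_farMajorant {H T : ℝ} (hH : 2 / 3 < H) (hT : 0 < T) (K : ℝ) :
    Integrable (farMajorant H T K) := by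
  refine Integrable.mul_prod (f := (Icc (0 : ℝ) T).indicator (fun _ => K)) ?_
    (Integrable.mul_prod (f := (Ioc (0 : ℝ) T).indicator (fun x => x ^ (2 * H - 2))) ?_
      ((integrable_profileOne hH).mul_prod (integrable_profileOne hH)))
  · rw [integrable_indicator_iff measurableSet_Icc]
    exact integrableOn_const (by simp)
  · rw [integrable_indicator_iff measurableSet_Ioc, ← intervalIntegrable_iff_integrableOn_Ioc_of_le hT.le]
    exact intervalIntegral.intervalIntegrable_rpow' (by linarith)

lemma integrable_farLimit {H T : ℝ} (hH : 2 / 3 < H) (hT : 0 < T) :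
    Integrable (farLimit H T) := by
  refine (integrable_farMajorant hH hT (H * (2 * H - 1))).mono'
    (measurable_farLimit H T).aestronglyMeasurable (Eventually.of_forall ?_)
  rintro ⟨s, x, v, w⟩
  have hK : 0 ≤ H * (2 * H - 1) := by apply mul_nonneg <;> linarith
  have hn := farMajorant_nonneg (T := T) (H := H) hK (s, x, v, w)
  by_cases h1 : 0 ≤ s ∧ 0 < x ∧ s + x < T
  · by_cases h2 : 0 < v
    · by_cases h3 : 0 < w
      · have : farLimit H T (s, x, v, w) = farMajorant H T (H * (2 * H - 1)) (s, x, v, w) := by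
          unfold farLimit farMajorant
          rw [indicator_of_mem (show (s, x) ∈ {q : ℝ × ℝ | 0 ≤ q.1 ∧ 0 < q.2 ∧ q.1 + q.2 < T} from h1),
            indicator_of_mem (show v ∈ Ioi (0 : ℝ) from h2), indicator_of_mem (show w ∈ Ioi (0 : ℝ) from h3),
            indicator_of_mem (show s ∈ Icc (0 : ℝ) T from ⟨h1.1, by linarith⟩),
            indicator_of_mem (show x ∈ Ioc (0 : ℝ) T from ⟨h1.2.1, by linarith⟩)]
          ring
        rw [this, Real.norm_of_nonneg hn]
      · unfold farLimit
        rw [indicator_of_notMem (show w ∉ Ioi (0 : ℝ) from h3)]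
        simpa using hn
    · unfold farLimit
      rw [indicator_of_notMem (show v ∉ Ioi (0 : ℝ) from h2)]
      simpa using hn
  · unfold farLimit
    rw [indicator_of_notMem (show (s, x) ∉ {q : ℝ × ℝ | 0 ≤ q.1 ∧ 0 < q.2 ∧ q.1 + q.2 < T} from h1)]
    simpa using hn

lemma integral_farLimit {H T : ℝ} (hH : 2 / 3 < H) (hT : 0 < T) :
    ∫ p, farLimit H T p = T ^ (2 * H) / 2 * (∫ t in Ioi 0, profileOne H t) ^ 2 := by
  set g := (Ioi (0 : ℝ)).indicator (profileOne H) with hg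
  have hgi : ∫ t, g t = ∫ t in Ioi 0, profileOne H t := integral_indicator measurableSet_Ioi
  rw [← hgi]
  have hs : ∀ s : ℝ, ∫ q : ℝ × ℝ × ℝ, farLimit H T (s, q) =
      (Icc (0 : ℝ) T).indicator (fun s => H * (T - s) ^ (2 * H - 1)) s * (∫ t, g t) ^ 2 := by
    intro s
    have e1 : ∫ q : ℝ × ℝ × ℝ, farLimit H T (s, q) =
        (∫ x, {q : ℝ × ℝ | 0 ≤ q.1 ∧ 0 < q.2 ∧ q.1 + q.2 < T}.indicator
          (fun q => H * (2 * H - 1) * q.2 ^ (2 * H - 2)) (s, x)) * (∫ t, g t) ^ 2 := by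
      rw [sq, ← integral_prod_mul (μ := (volume : Measure ℝ)) (ν := (volume : Measure ℝ)) g g,
        ← integral_prod_mul]
      rfl
    rw [e1]
    congr 1
    by_cases h : s ∈ Icc (0 : ℝ) T
    · have e2 : (fun x => {q : ℝ × ℝ | 0 ≤ q.1 ∧ 0 < q.2 ∧ q.1 + q.2 < T}.indicator
          (fun q => H * (2 * H - 1) * q.2 ^ (2 * H - 2)) (s, x)) =
          (Ioo 0 (T - s)).indicator (fun x => H * (2 * H - 1) * x ^ (2 * H - 2)) := by
        funext x
        by_cases hx : x ∈ Ioo 0 (T - s)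
        · rw [indicator_of_mem hx, indicator_of_mem]
          exact ⟨h.1, hx.1, by linarith [hx.2]⟩
        · rw [indicator_of_notMem hx, indicator_of_notMem]
          rintro ⟨-, h2, h3⟩
          exact hx ⟨h2, by linarith⟩
      rw [e2, integral_indicator measurableSet_Ioo, indicator_of_mem h,
        ← integral_Ioc_eq_integral_Ioo, ← intervalIntegral.integral_of_le (by linarith [h.2]),
        intervalIntegral.integral_const_mul, integral_rpow (Or.inl (by linarith)),
        Real.zero_rpow (by linarith), show 2 * H - 2 + 1 = 2 * H - 1 by ring, sub_zero]
      rw [mul_assoc, mul_div_cancel₀ _ (by linarith)]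
    · rw [indicator_of_notMem h]
      have e2 : (fun x => {q : ℝ × ℝ | 0 ≤ q.1 ∧ 0 < q.2 ∧ q.1 + q.2 < T}.indicator
          (fun q => H * (2 * H - 1) * q.2 ^ (2 * H - 2)) (s, x)) = fun _ => 0 := by
        funext x
        rw [indicator_of_notMem]
        rintro ⟨h1, h2, h3⟩
        exact h ⟨h1, by dsimp only at *; linarith⟩
      rw [e2, integral_zero]
  have hprod := integral_prod (μ := (volume : Measure ℝ)) (ν := (volume : Measure (ℝ × ℝ × ℝ)))
    (farLimit H T) (integrable_farLimit hH hT)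
  rw [show (∫ p, farLimit H T p) = ∫ p, farLimit H T p ∂((volume : Measure ℝ).prod
    (volume : Measure (ℝ × ℝ × ℝ))) from rfl, hprod]
  simp_rw [hs]
  rw [integral_mul_const, integral_indicator measurableSet_Icc, integral_Icc_eq_integral_Ioc,
    ← intervalIntegral.integral_of_le hT.le, intervalIntegral.integral_const_mul,
    intervalIntegral.integral_comp_sub_left (fun x => x ^ (2 * H - 1)) T,
    integral_rpow (Or.inl (by linarith)), sub_self, sub_zero, show 2 * H - 1 + 1 = 2 * H by ring,
    Real.zero_rpow (by linarith)]
  have : H ≠ 0 := by linarith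
  field_simp
  ring

lemma tendsto_far {H T : ℝ} (hT : 0 < T) (hH : H ∈ Ioo (2 / 3 : ℝ) 1) :
    Tendsto (fun δ : ℝ => δ ^ (6 * H - 4) *
        ∫ p, (regFar T).indicator (momentIntegrand H (δ ^ (2 * H))) p)
      (nhdsWithin 0 (Ioi 0)) (nhds (∫ p, farLimit H T p)) ∧
    ∀ δ, 0 < δ → Integrable ((regFar T).indicator (momentIntegrand H (δ ^ (2 * H)))) := by
  obtain ⟨hH1, hH2⟩ := hH
  obtain ⟨C, hC0, hC⟩ := detOne_bounds (H := H) ⟨by linarith, hH2⟩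
  have hHH : 0 ≤ H * (2 * H - 1) := by apply mul_nonneg <;> linarith
  set F : ℝ → ℝ × ℝ × ℝ × ℝ → ℝ := fun δ =>
    (regFar T).indicator (momentIntegrand H (δ ^ (2 * H))) with hF
  have h0 : ∀ δ p, paramMap 1 δ p ∉ regFar T →
      δ ^ (6 * H - 4) * (1 * δ ^ 2) * F δ (paramMap 1 δ p) = 0 := by
    intro δ p hp
    simp only [hF]
    rw [indicator_of_notMem hp, mul_zero]
  have hG : ∀ δ s x v w, ∃ η, 0 < δ → paramMap 1 δ (s, x, v, w) ∈ regFar T →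
      x - δ * v ≤ η ∧ η ≤ x + δ * w ∧
      mu H (x / δ) v w = H * (2 * H - 1) * v * w * η ^ (2 * H - 2) * δ ^ (2 - 2 * H) ∧
      δ ^ (6 * H - 4) * (1 * δ ^ 2) * F δ (paramMap 1 δ (s, x, v, w)) =
        detOne H (x / δ) v w ^ (-(3 / 2 : ℝ)) * (H * (2 * H - 1) * v * w * η ^ (2 * H - 2)) := by
    intro δ s x v w
    by_cases h : 0 < δ ∧ paramMap 1 δ (s, x, v, w) ∈ regFar T
    · obtain ⟨hδ, hmem⟩ := h
      obtain ⟨-, hx, hv, hw, -, hxv⟩ := (paramMap_mem_regFar hδ).1 hmem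
      have hy : 0 < x / δ := by positivity
      obtain ⟨η, ⟨hη1, hη2⟩, hη⟩ := exists_mu_eq (H := H) (by linarith) hy hv hw
        (by rw [le_div_iff₀ hδ]; linarith)
      have hxδ : δ * (x / δ) = x := mul_div_cancel₀ _ hδ.ne'
      have b1 : x - δ * v ≤ δ * η := by
        calc x - δ * v = δ * (x / δ - v) := by rw [mul_sub, hxδ]
          _ ≤ _ := by gcongr
      have b2 : δ * η ≤ x + δ * w := by
        calc δ * η ≤ δ * (x / δ + w) := by gcongr
          _ = _ := by rw [mul_add, hxδ]
      have hη0 : 0 ≤ η := by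
        have : 0 ≤ δ * η := by linarith
        exact nonneg_of_mul_nonneg_right this hδ
      have hmu : mu H (x / δ) v w =
          H * (2 * H - 1) * v * w * (δ * η) ^ (2 * H - 2) * δ ^ (2 - 2 * H) := by
        rw [hη, Real.mul_rpow hδ.le hη0]
        have : δ ^ (2 * H - 2) * δ ^ (2 - 2 * H) = 1 := by
          rw [← Real.rpow_add hδ]; simp
        linear_combination (-(H * (2 * H - 1) * v * w * η ^ (2 * H - 2))) * this
      refine ⟨δ * η, fun _ _ => ⟨b1, b2, hmu, ?_⟩⟩
      have e : paramMap 1 δ (s, x, v, w) = paramMap δ δ (s, x / δ, v, w) := by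
        simp only [paramMap, hxδ, one_mul]
      simp only [hF]
      rw [indicator_of_mem hmem, e,
        momentIntegrand_paramMap hδ hy.le hv hw (hC _ v w hy.le hv hw).1, hmu]
      have e' : δ ^ (6 * H - 4) * (1 * δ ^ 2) * δ ^ (-(4 * H)) * δ ^ (2 - 2 * H) = 1 := by
        rw [show 1 * δ ^ 2 = δ ^ (2 : ℝ) by norm_cast; ring, ← Real.rpow_add hδ,
          ← Real.rpow_add hδ, ← Real.rpow_add hδ]
        ring_nf
        exact Real.rpow_zero _
      linear_combination (detOne H (x / δ) v w ^ (-(3 / 2 : ℝ)) *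
        (H * (2 * H - 1) * v * w * (δ * η) ^ (2 * H - 2))) * e'
    · exact ⟨0, fun h1 h2 => absurd ⟨h1, h2⟩ h⟩
  set K : ℝ := C * (H * (2 * H - 1)) * (1 / 2) ^ (2 * H - 2) with hK
  have hK0 : 0 ≤ K := by positivity
  have key := tendsto_integral_of_paramMap (F := F) (L := farLimit H T) (Bd := farMajorant H T K)
    (c := fun δ => δ ^ (6 * H - 4)) (d₁ := fun _ => 1) (d₂ := fun δ => δ)
    (fun δ hδ => by positivity) (fun δ hδ => one_pos) (fun δ hδ => hδ)
    (fun δ => (measurable_momentIntegrand _ _).indicator (measurableSet_regFar T))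
    (integrable_farMajorant hH1 hT K) ?_ ?_
  · exact key
  · rintro δ hδ ⟨s, x, v, w⟩
    by_cases hmem : paramMap 1 δ (s, x, v, w) ∈ regFar T
    · obtain ⟨η, hη⟩ := hG δ s x v w
      obtain ⟨hη1, -, -, hη⟩ := hη hδ hmem
      obtain ⟨hs, hx, hv, hw, hT', hxv⟩ := (paramMap_mem_regFar hδ).1 hmem
      have hδw := mul_nonneg hδ.le hw
      have hη2 : 1 / 2 * x ≤ η := by linarith
      have hη0 : 0 < η := by linarith
      have hp : η ^ (2 * H - 2) ≤ (1 / 2) ^ (2 * H - 2) * x ^ (2 * H - 2) := by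
        rw [← Real.mul_rpow (by norm_num) hx.le]
        exact Real.rpow_le_rpow_of_nonpos (by positivity) hη2 (by linarith)
      obtain ⟨hD, hD', -⟩ := hC (x / δ) v w (by positivity) hv hw
      have hD'' := hD' (by rw [le_div_iff₀ hδ]; linarith [mul_nonneg hδ.le hv])
      rw [hη, abs_of_nonneg (by positivity)]
      unfold farMajorant
      rw [indicator_of_mem (show s ∈ Icc (0 : ℝ) T from ⟨hs, by linarith⟩),
        indicator_of_mem (show x ∈ Ioc (0 : ℝ) T from ⟨hx, by linarith⟩)]
      simp only [profileOne, abs_of_nonneg hv, abs_of_nonneg hw]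
      calc _ ≤ C * ((1 + v ^ (2 * H)) ^ (-(3 / 2 : ℝ)) * (1 + w ^ (2 * H)) ^ (-(3 / 2 : ℝ))) *
            (H * (2 * H - 1) * v * w * ((1 / 2) ^ (2 * H - 2) * x ^ (2 * H - 2))) :=
            mul_le_mul hD'' (mul_le_mul_of_nonneg_left hp (by positivity)) (by positivity)
              (by positivity)
        _ = _ := by rw [hK]; ring
    · rw [h0 δ _ hmem, abs_zero]
      exact farMajorant_nonneg hK0 _
  · rintro ⟨s, x, v, w⟩
    by_cases hc : (0 ≤ s ∧ 0 < x ∧ s + x < T) ∧ 0 < v ∧ 0 < w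
    · obtain ⟨⟨hs, hx, hT'⟩, hv, hw⟩ := hc
      choose η hη using fun δ => hG δ s x v w
      have lin : ∀ a b : ℝ, Tendsto (fun δ : ℝ => a + δ * b) (nhdsWithin 0 (Ioi 0)) (nhds a) := by
        intro a b
        have : Tendsto (fun δ : ℝ => a + δ * b) (nhds 0) (nhds (a + 0 * b)) :=
          Continuous.tendsto (by fun_prop) 0
        rw [zero_mul, add_zero] at this
        exact this.mono_left nhdsWithin_le_nhds
      have hev : ∀ᶠ δ in nhdsWithin (0 : ℝ) (Ioi 0), 0 < δ ∧ paramMap 1 δ (s, x, v, w) ∈ regFar T := by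
        filter_upwards [self_mem_nhdsWithin, (lin (s + x) w).eventually (gt_mem_nhds hT'),
          (lin 0 (2 * v)).eventually (gt_mem_nhds hx)] with δ hδ h1 h2
        exact ⟨hδ, (paramMap_mem_regFar hδ).2 ⟨hs, hx, hv.le, hw.le, h1.le, by linarith⟩⟩
      have hηx : Tendsto η (nhdsWithin 0 (Ioi 0)) (nhds x) := by
        refine tendsto_of_tendsto_of_tendsto_of_le_of_le' (lin x (-v)) (lin x w) ?_ ?_
        · filter_upwards [hev] with δ hδ
          have := (hη δ hδ.1 hδ.2).1
          linarith
        · filter_upwards [hev] with δ hδ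
          exact (hη δ hδ.1 hδ.2).2.1
      have hηp : Tendsto (fun δ => H * (2 * H - 1) * v * w * η δ ^ (2 * H - 2))
          (nhdsWithin 0 (Ioi 0)) (nhds (H * (2 * H - 1) * v * w * x ^ (2 * H - 2))) :=
        ((Real.continuousAt_rpow_const x _ (Or.inl hx.ne')).tendsto.comp hηx).const_mul _
      have hδp : Tendsto (fun δ : ℝ => δ ^ (2 - 2 * H)) (nhdsWithin 0 (Ioi 0)) (nhds 0) := by
        have h := (Real.continuousAt_rpow_const 0 (2 - 2 * H) (Or.inr (by linarith))).tendsto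
        rw [Real.zero_rpow (by linarith)] at h
        exact h.mono_left nhdsWithin_le_nhds
      have hmu : Tendsto (fun δ => mu H (x / δ) v w) (nhdsWithin 0 (Ioi 0)) (nhds 0) := by
        have := hηp.mul hδp
        rw [mul_zero] at this
        refine this.congr' ?_
        filter_upwards [hev] with δ hδ
        exact (hη δ hδ.1 hδ.2).2.2.1.symm
      have hdet : Tendsto (fun δ => detOne H (x / δ) v w) (nhdsWithin 0 (Ioi 0))
          (nhds ((1 + v ^ (2 * H)) * (1 + w ^ (2 * H)))) := by
        have := (hmu.pow 2).const_sub ((1 + v ^ (2 * H)) * (1 + w ^ (2 * H)))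
        simpa [detOne] using this
      have hdet' : Tendsto (fun δ => detOne H (x / δ) v w ^ (-(3 / 2 : ℝ))) (nhdsWithin 0 (Ioi 0))
          (nhds (((1 + v ^ (2 * H)) * (1 + w ^ (2 * H))) ^ (-(3 / 2 : ℝ)))) :=
        (Real.continuousAt_rpow_const _ _ (Or.inl (by positivity))).tendsto.comp hdet
      have hL : farLimit H T (s, x, v, w) = ((1 + v ^ (2 * H)) * (1 + w ^ (2 * H))) ^ (-(3 / 2 : ℝ)) *
          (H * (2 * H - 1) * v * w * x ^ (2 * H - 2)) := by
        unfold farLimit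
        rw [indicator_of_mem (show (s, x) ∈ {q : ℝ × ℝ | 0 ≤ q.1 ∧ 0 < q.2 ∧ q.1 + q.2 < T} from
            ⟨hs, hx, hT'⟩), indicator_of_mem (show v ∈ Ioi (0 : ℝ) from hv),
          indicator_of_mem (show w ∈ Ioi (0 : ℝ) from hw)]
        simp only [profileOne, abs_of_pos hv, abs_of_pos hw]
        rw [Real.mul_rpow (by positivity) (by positivity)]
        ring
      rw [hL]
      refine (hdet'.mul hηp).congr' ?_
      filter_upwards [hev] with δ hδ
      exact (hη δ hδ.1 hδ.2).2.2.2.symm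
    · have hL : farLimit H T (s, x, v, w) = 0 := by
        unfold farLimit
        by_cases h1 : 0 ≤ s ∧ 0 < x ∧ s + x < T
        · by_cases h2 : 0 < v
          · rw [indicator_of_notMem (s := Ioi (0 : ℝ)) (show w ∉ Ioi (0 : ℝ) from
              fun h3 => hc ⟨h1, h2, h3⟩)]
            simp
          · rw [indicator_of_notMem (show v ∉ Ioi (0 : ℝ) from h2)]
            simp
        · rw [indicator_of_notMem (show (s, x) ∉ {q : ℝ × ℝ | 0 ≤ q.1 ∧ 0 < q.2 ∧ q.1 + q.2 < T}
            from h1)]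
          simp
      rw [hL]
      refine tendsto_const_nhds.congr' ?_
      filter_upwards [self_mem_nhdsWithin] with δ hδ
      have hδ : 0 < δ := hδ
      by_cases hmem : paramMap 1 δ (s, x, v, w) ∈ regFar T
      · obtain ⟨η, hη⟩ := hG δ s x v w
        obtain ⟨-, -, -, hη⟩ := hη hδ hmem
        obtain ⟨hs, hx, hv, hw, hT', hxv⟩ := (paramMap_mem_regFar hδ).1 hmem
        have hvw : v * w = 0 := by
          by_contra hne
          have hv' : 0 < v := lt_of_le_of_ne hv (fun h => hne (by rw [← h, zero_mul]))
          have hw' : 0 < w := lt_of_le_of_ne hw (fun h => hne (by rw [← h, mul_zero]))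
          have := mul_pos hδ hw'
          exact hc ⟨⟨hs, hx, by linarith⟩, hv', hw'⟩
        rw [hη]
        linear_combination (-(detOne H (x / δ) v w ^ (-(3 / 2 : ℝ)) *
          (H * (2 * H - 1) * η ^ (2 * H - 2)))) * hvw
      · exact (h0 δ _ hmem).symm

lemma tendsto_rpow_mul_integral_momentIntegrand {H T : ℝ} (hT : 0 < T)
    (hH : H ∈ Ioo (2 / 3 : ℝ) 1) :
    Tendsto (fun δ : ℝ => δ ^ (6 * H - 4) * ∫ p in regS T, momentIntegrand H (δ ^ (2 * H)) p)
      (nhdsWithin 0 (Ioi 0)) (nhds (T ^ (2 * H) / 2 * (∫ t in Ioi 0, profileOne H t) ^ 2)) := by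
  obtain ⟨hf, hfi⟩ := tendsto_far hT hH
  obtain ⟨hn, hni⟩ := tendsto_near hT hH
  have := hf.add hn
  rw [integral_farLimit hH.1 hT, add_zero] at this
  refine this.congr' ?_
  filter_upwards [self_mem_nhdsWithin] with δ hδ
  rw [← mul_add, ← integral_add (hfi δ hδ) (hni δ hδ), ← integral_indicator (measurableSet_regS T)]
  congr 2
  funext p
  have hsub : regFar T ⊆ regS T := inter_subset_left
  by_cases h1 : p ∈ regFar T
  · simp [h1, hsub h1]
  · by_cases h2 : p ∈ regS T <;> simp [h1, h2]

/-- For `2/3 < H < 1`, `ε^{3 - 2/H} · (1/π) ∫_𝒮 det(εI+Σ)^{-3/2} Σ₁₂ → σ²` as `ε → 0⁺`,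
where `σ² = T^{2H}(2H-1)/(4Hπ) · B(1/H, (3H-2)/(2H))² · B(2, 2H-1)`; equivalently,
`ε^{3-2/H} 𝔼[α_ε²] → σ²`. -/
theorem tendsto_variance_alpha (T : ℝ) (hT : 0 < T) (H : ℝ) (hH : H ∈ Ioo (2/3 : ℝ) 1) :
    Tendsto (fun ε : ℝ => ε ^ (3 - 2/H) * halfMomentAlpha H T ε) (nhdsWithin 0 (Ioi 0))
      (nhds (T ^ (2*H) * (2*H - 1) / (4*H*π) *
        betaFn (1/H) ((3*H - 2) / (2*H)) ^ 2 * betaFn 2 (2*H - 1))) := by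
  have hH1 := hH.1
  have hH0 : 0 < H := by linarith
  have hroot : Tendsto (fun ε : ℝ => ε ^ (1 / (2 * H))) (nhdsWithin 0 (Ioi 0))
      (nhdsWithin 0 (Ioi 0)) := by
    refine tendsto_nhdsWithin_iff.2 ⟨?_, ?_⟩
    · have h := (Real.continuousAt_rpow_const 0 (1 / (2 * H)) (Or.inr (by positivity))).tendsto
      rw [Real.zero_rpow (by positivity)] at h
      exact h.mono_left nhdsWithin_le_nhds
    · filter_upwards [self_mem_nhdsWithin] with ε hε
      exact Real.rpow_pos_of_pos hε _
  have key := ((tendsto_rpow_mul_integral_momentIntegrand hT hH).comp hroot).const_mul (1 / π)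
  have hlim : 1 / π * (T ^ (2 * H) / 2 * (∫ t in Ioi 0, profileOne H t) ^ 2) =
      T ^ (2*H) * (2*H - 1) / (4*H*π) *
        betaFn (1/H) ((3*H - 2) / (2*H)) ^ 2 * betaFn 2 (2*H - 1) := by
    rw [integral_profileOne hH0, betaFn_two (by linarith)]
    have h2 : 2 * H - 1 ≠ 0 := by linarith
    generalize betaFn (1/H) ((3*H - 2) / (2*H)) = b
    generalize T ^ (2 * H) = t
    generalize hk : 2 * H - 1 = k at h2 ⊢
    field_simp
    ring
  rw [← hlim]
  refine key.congr' ?_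
  filter_upwards [self_mem_nhdsWithin] with ε hε
  have hε : 0 < ε := hε
  have e1 : (ε ^ (1 / (2 * H))) ^ (6 * H - 4) = ε ^ (3 - 2 / H) := by
    rw [← Real.rpow_mul hε.le]
    congr 1
    field_simp
    ring
  have e2 : (ε ^ (1 / (2 * H))) ^ (2 * H) = ε := by
    rw [← Real.rpow_mul hε.le, one_div_mul_cancel (by positivity), Real.rpow_one]
  simp only [Function.comp_apply, e1, e2]
  unfold halfMomentAlpha momentIntegrand
  ring
end

section
/- Let $T>0$, let $q\ge2$ be an integer, and let $\tfrac34<H<\tfrac{4q-3}{4q-2}$. Define $E_q(\varepsilon) := 2(2q-1)!\,\beta_q^2\int_{\mathcal{S}} G^{(q)}_{\varepsilon,\,s_2-s_1}(t_1-s_1,\,t_2-s_2)\; ds_1\, ds_2\, dt_1\, dt_2$ for $\varepsilon>0$. Then the constant $\sigma_q^2 := 2(2q-1)!\,\beta_q^2\, T\int_{\mathbb{R}_+^3} G^{(q)}_{1,x}(u_1,u_2)\, dx\, du_1\, du_2$ is finite, and $\lim_{\varepsilon\to0^+}\varepsilon^{2-\frac{3}{2H}} E_q(\varepsilon) = \sigma_q^2$.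 (Here $E_q(\varepsilon) = \mathbb{E}[I_{2q-1}(f_{2q-1,\varepsilon})^2]$ is the variance of the $(2q-1)$-th Wiener chaos component of the approximating derivative of self-intersection local time of fractional Brownian motion.) -/
open Real Set MeasureTheory Filter

/-- The kernel `G^{(q)}_{ε,x}(u₁,u₂) = (ε + u₁^{2H})^{-1/2-q} (ε + u₂^{2H})^{-1/2-q}
μ_H(x,u₁,u₂)^{2q-1}`. -/
noncomputable def G (H : ℝ) (q : ℕ) (ε x u₁ u₂ : ℝ) : ℝ :=
  (ε + u₁ ^ (2*H)) ^ (-(1/2 : ℝ) - (q : ℝ)) * (ε + u₂ ^ (2*H)) ^ (-(1/2 : ℝ) - (q : ℝ)) *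
    mu H x u₁ u₂ ^ (2*q - 1)

/-- The constant `β_q = (2^{q-1/2} (q-1)! √π)⁻¹`. -/
noncomputable def betaConst (q : ℕ) : ℝ :=
  ((2 : ℝ) ^ ((q : ℝ) - 1/2) * (Nat.factorial (q - 1)) * Real.sqrt π)⁻¹

/-- `E_q(ε) = 𝔼[I_{2q-1}(f_{2q-1,ε})²]`, the variance of the `(2q-1)`-th Wiener chaos
component of the approximating derivative of self-intersection local time. -/
noncomputable def Evar (H T : ℝ) (q : ℕ) (ε : ℝ) : ℝ :=
  2 * (Nat.factorial (2*q - 1)) * betaConst q ^ 2 *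
    ∫ p in regS T, G H q ε (p.2.1 - p.1) (p.2.2.1 - p.1) (p.2.2.2 - p.2.1)

lemma abs_rpow_add_sub_rpow_le {e t v : ℝ} (he0 : 0 < e) (he1 : e ≤ 1) (ht : 0 ≤ t) (hv : 0 ≤ v) :
    |(t + v) ^ e - t ^ e| ≤ v ^ e := by
  have h1 := Real.rpow_add_le_add_rpow ht hv he0.le he1
  have h2 : t ^ e ≤ (t + v) ^ e := Real.rpow_le_rpow ht (by linarith) he0.le
  rw [abs_of_nonneg (by linarith)]
  linarith

lemma abs_rpow_mul_self_of_nonneg {D t : ℝ} (hD : 1 < D) (ht : 0 ≤ t) :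
    |t| ^ (D - 2) * t = t ^ (D - 1) := by
  rcases ht.eq_or_lt with rfl | ht
  · rw [mul_zero, Real.zero_rpow (by linarith)]
  · rw [abs_of_pos ht, show D - 1 = (D - 2) + 1 by ring, Real.rpow_add_one ht.ne']

lemma abs_rpow_mul_self_of_nonpos {D t : ℝ} (hD : 1 < D) (ht : t ≤ 0) :
    |t| ^ (D - 2) * t = -(-t) ^ (D - 1) := by
  rw [← abs_rpow_mul_self_of_nonneg hD (neg_nonneg.2 ht), abs_neg]
  ring

/-- Hölder continuity of the signed power `t ↦ |t| ^ (D - 2) * t`. -/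
lemma abs_signedPow_add_sub_le {D : ℝ} (hD1 : 1 < D) (hD2 : D < 2) (t : ℝ) {v : ℝ} (hv : 0 ≤ v) :
    |(|t + v| ^ (D - 2) * (t + v)) - |t| ^ (D - 2) * t| ≤ 2 * v ^ (D - 1) := by
  have hvp : 0 ≤ v ^ (D - 1) := Real.rpow_nonneg hv _
  rcases le_total 0 t with ht | ht
  · rw [abs_rpow_mul_self_of_nonneg hD1 ht, abs_rpow_mul_self_of_nonneg hD1 (by linarith)]
    have := abs_rpow_add_sub_rpow_le (e := D - 1) (by linarith) (by linarith) ht hv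
    linarith
  rcases le_total 0 (t + v) with htv | htv
  · rw [abs_rpow_mul_self_of_nonpos hD1 ht, abs_rpow_mul_self_of_nonneg hD1 htv]
    have h1 : (t + v) ^ (D - 1) ≤ v ^ (D - 1) :=
      Real.rpow_le_rpow htv (by linarith) (by linarith)
    have h2 : (-t) ^ (D - 1) ≤ v ^ (D - 1) :=
      Real.rpow_le_rpow (by linarith) (by linarith) (by linarith)
    have h3 := Real.rpow_nonneg htv (D - 1)
    have h4 := Real.rpow_nonneg (neg_nonneg.2 ht) (D - 1)
    rw [abs_of_nonneg (by linarith)]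
    linarith
  · rw [abs_rpow_mul_self_of_nonpos hD1 ht, abs_rpow_mul_self_of_nonpos hD1 htv]
    have := abs_rpow_add_sub_rpow_le (e := D - 1) (t := -(t + v)) (v := v) (by linarith)
      (by linarith) (by linarith) hv
    rw [show -(t + v) + v = -t by ring] at this
    rw [show -(-(t + v)) ^ (D - 1) - -(-t) ^ (D - 1)
      = (-t) ^ (D - 1) - (-(t + v)) ^ (D - 1) by ring]
    linarith

/-- Lipschitz bound for the signed power away from the origin. -/
lemma abs_signedPow_add_sub_le_of_pos {D : ℝ} (hD1 : 1 < D) (hD2 : D < 2) {t v c : ℝ} (hc : 0 < c)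
    (hct : c ≤ t) (hv : 0 ≤ v) :
    |(|t + v| ^ (D - 2) * (t + v)) - |t| ^ (D - 2) * t| ≤ v * c ^ (D - 2) := by
  have ht : 0 < t := hc.trans_le hct
  rw [abs_rpow_mul_self_of_nonneg hD1 ht.le, abs_rpow_mul_self_of_nonneg hD1 (by linarith)]
  have h2 : t ^ (D - 1) ≤ (t + v) ^ (D - 1) := Real.rpow_le_rpow ht.le (by linarith) (by linarith)
  rw [abs_of_nonneg (by linarith)]
  have h3 : (1 + v / t) ^ (D - 1) ≤ 1 + (D - 1) * (v / t) :=
    rpow_one_add_le_one_add_mul_self (by have := div_nonneg hv ht.le; linarith)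
      (by linarith) (by linarith)
  have h4 : (t + v) ^ (D - 1) = t ^ (D - 1) * (1 + v / t) ^ (D - 1) := by
    rw [← Real.mul_rpow ht.le (by positivity)]
    congr 1
    field_simp
  have h5 : t ^ (D - 1) = t ^ (D - 2) * t := by
    rw [← Real.rpow_add_one ht.ne']
    congr 1
    ring
  have h6 : t ^ (D - 2) ≤ c ^ (D - 2) := Real.rpow_le_rpow_of_nonpos hc hct (by linarith)
  calc (t + v) ^ (D - 1) - t ^ (D - 1)
      ≤ t ^ (D - 1) * (1 + (D - 1) * (v / t)) - t ^ (D - 1) := by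
        rw [h4]
        gcongr
    _ = (D - 1) * (v * t ^ (D - 2)) := by
        rw [h5]
        field_simp
        ring
    _ ≤ 1 * (v * t ^ (D - 2)) := by
        have : 0 ≤ v * t ^ (D - 2) := by positivity
        gcongr
        linarith
    _ ≤ v * c ^ (D - 2) := by
        rw [one_mul]
        gcongr

/-- A mean value bound for second differences of `|·| ^ D`. -/
lemma abs_second_diff_le {D : ℝ} (hD : 1 < D) {a v w K : ℝ} (hw : 0 ≤ w)
    (hK : ∀ b, 0 ≤ b → |(|a + b + v| ^ (D - 2) * (a + b + v)) - |a + b| ^ (D - 2) * (a + b)| ≤ K) :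
    |(|a + w + v| ^ D - |a + w| ^ D) - (|a + v| ^ D - |a| ^ D)| ≤ D * K * w := by
  have hd : ∀ b ∈ Icc 0 w, HasDerivWithinAt (fun b : ℝ => |a + b + v| ^ D - |a + b| ^ D)
      (D * |a + b + v| ^ (D - 2) * (a + b + v) - D * |a + b| ^ (D - 2) * (a + b)) (Icc 0 w) b := by
    intro b _
    have h1 := (hasDerivAt_abs_rpow (a + b + v) hD).comp b
      (((hasDerivAt_id b).const_add a).add_const v)
    have h2 := (hasDerivAt_abs_rpow (a + b) hD).comp b ((hasDerivAt_id b).const_add a)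
    exact ((h1.sub h2).congr_deriv (by simp)).hasDerivWithinAt
  have h := norm_image_sub_le_of_norm_deriv_le_segment' hd (C := D * K) (fun b hb => by
    rw [Real.norm_eq_abs, show D * |a + b + v| ^ (D - 2) * (a + b + v)
      - D * |a + b| ^ (D - 2) * (a + b) = D * ((|a + b + v| ^ (D - 2) * (a + b + v))
        - |a + b| ^ (D - 2) * (a + b)) by ring, abs_mul, abs_of_pos (by linarith : 0 < D)]
    exact mul_le_mul_of_nonneg_left (hK b hb.1) (by linarith)) w ⟨hw, le_rfl⟩
  simpa using h

lemma mu_eq_abs (H : ℝ) {x u₁ u₂ : ℝ} (hx : 0 ≤ x) (h₂ : 0 ≤ u₂) :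
    mu H x u₁ u₂ = (1/2) * ((|x - u₁ + u₂ + u₁| ^ (2*H) - |x - u₁ + u₂| ^ (2*H))
      - (|x - u₁ + u₁| ^ (2*H) - |x - u₁| ^ (2*H))) := by
  rw [mu, sub_add_cancel, abs_of_nonneg hx, show x - u₁ + u₂ + u₁ = x + u₂ by ring,
    show x - u₁ + u₂ = x + u₂ - u₁ by ring, abs_of_nonneg (add_nonneg hx h₂)]
  ring

lemma abs_mu_le_left {H x u₁ u₂ : ℝ} (hH0 : 1/2 < H) (hH1 : H < 1) (hx : 0 ≤ x) (h₁ : 0 ≤ u₁)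
    (h₂ : 0 ≤ u₂) : |mu H x u₁ u₂| ≤ 4 * (u₁ ^ (2*H - 1) * u₂) := by
  have h := abs_second_diff_le (D := 2*H) (a := x - u₁) (v := u₁) (by linarith) h₂
    (fun b _ => abs_signedPow_add_sub_le (by linarith) (by linarith) (x - u₁ + b) h₁)
  rw [mu_eq_abs H hx h₂, abs_mul, abs_of_pos (by norm_num : (0:ℝ) < 1/2)]
  have : 0 ≤ u₁ ^ (2*H - 1) * u₂ := by positivity
  nlinarith

lemma abs_mu_le_right {H x u₁ u₂ : ℝ} (hH0 : 1/2 < H) (hH1 : H < 1) (hx : 0 ≤ x) (h₁ : 0 ≤ u₁)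
    (h₂ : 0 ≤ u₂) : |mu H x u₁ u₂| ≤ 4 * (u₁ * u₂ ^ (2*H - 1)) := by
  have h := abs_second_diff_le (D := 2*H) (a := x - u₁) (v := u₂) (by linarith) h₁
    (fun b _ => abs_signedPow_add_sub_le (by linarith) (by linarith) (x - u₁ + b) h₂)
  rw [mu_eq_abs H hx h₂, abs_mul, abs_of_pos (by norm_num : (0:ℝ) < 1/2),
    show ∀ A B C D : ℝ, (A - B) - (C - D) = (A - C) - (B - D) by intros; ring,
    show x - u₁ + u₂ + u₁ = x - u₁ + u₁ + u₂ by ring]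
  have : 0 ≤ u₁ * u₂ ^ (2*H - 1) := by positivity
  nlinarith

/-- Self-similar (Cauchy–Schwarz type) bound for the covariance. -/
lemma abs_mu_le_mul_rpow {H x u₁ u₂ : ℝ} (hH0 : 1/2 < H) (hH1 : H < 1) (hx : 0 ≤ x) (h₁ : 0 < u₁)
    (h₂ : 0 < u₂) : |mu H x u₁ u₂| ≤ 4 * (u₁ * u₂) ^ H := by
  refine abs_le_of_sq_le_sq ?_ (by positivity)
  have hA := abs_mu_le_left hH0 hH1 hx h₁.le h₂.le
  have hB := abs_mu_le_right hH0 hH1 hx h₁.le h₂.le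
  have hm := mul_le_mul hA hB (abs_nonneg _) (by positivity)
  have hp : ((u₁ * u₂) ^ H) ^ 2 = (u₁ ^ (2*H - 1) * u₂) * (u₁ * u₂ ^ (2*H - 1)) := by
    rw [← Real.rpow_natCast, ← Real.rpow_mul (by positivity), Real.mul_rpow h₁.le h₂.le,
      show H * (2 : ℕ) = (2*H - 1) + 1 by push_cast; ring, Real.rpow_add_one h₁.ne',
      Real.rpow_add_one h₂.ne']
    ring
  rw [← sq_abs]
  nlinarith

/-- Decay of the covariance in the distance between the increments. -/
lemma abs_mu_le_decay {H x u₁ u₂ : ℝ} (hH0 : 1/2 < H) (hH1 : H < 1) (hx : 0 < x) (h₁ : 0 < u₁)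
    (h₂ : 0 < u₂) : |mu H x u₁ u₂| ≤ 8 * ((u₁ * u₂) * x ^ (2*H - 2)) := by
  have hhalf : (x/2) ^ (2*H - 2) ≤ 2 * x ^ (2*H - 2) := by
    rw [Real.div_rpow hx.le (by norm_num), div_eq_mul_inv, ← Real.rpow_neg (by norm_num), mul_comm]
    gcongr
    calc (2:ℝ) ^ (-(2*H - 2)) ≤ 2 ^ (1:ℝ) := by
          apply Real.rpow_le_rpow_of_exponent_le <;> linarith
      _ = 2 := Real.rpow_one 2
  have hu : 0 < u₁ * u₂ := by positivity
  suffices |mu H x u₁ u₂| ≤ 4 * ((u₁ * u₂) * (x/2) ^ (2*H - 2)) by nlinarith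
  rcases le_total (x/2) u₁ with hxu | hxu
  · refine (abs_mu_le_left hH0 hH1 hx.le h₁.le h₂.le).trans ?_
    have h3 : u₁ ^ (2*H - 1) = u₁ ^ (2*H - 2) * u₁ := by
      rw [← Real.rpow_add_one h₁.ne']
      congr 1
      ring
    have h4 : u₁ ^ (2*H - 2) ≤ (x/2) ^ (2*H - 2) :=
      Real.rpow_le_rpow_of_nonpos (by linarith) hxu (by linarith)
    rw [h3]
    nlinarith
  · have h := abs_second_diff_le (D := 2*H) (a := x - u₁) (v := u₁) (by linarith) h₂.le
      (fun b hb => abs_signedPow_add_sub_le_of_pos (c := x/2) (by linarith) (by linarith)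
        (by linarith) (by linarith) h₁.le)
    rw [mu_eq_abs H hx.le h₂.le, abs_mul, abs_of_pos (by norm_num : (0:ℝ) < 1/2)]
    have : 0 ≤ (u₁ * u₂) * (x/2) ^ (2*H - 2) := by positivity
    nlinarith

lemma abs_mu_le_interp {H x u₁ u₂ θ : ℝ} (hH0 : 1/2 < H) (hH1 : H < 1) (hx : 0 < x) (h₁ : 0 < u₁)
    (h₂ : 0 < u₂) (hθ0 : 0 ≤ θ) (hθ1 : θ ≤ 1) :
    |mu H x u₁ u₂| ≤ 8 * ((u₁ * u₂) ^ (H + θ * (1 - H)) * x ^ (-(θ * (2 - 2*H)))) := by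
  have hu : 0 < u₁ * u₂ := by positivity
  have hA : |mu H x u₁ u₂| ≤ 8 * (u₁ * u₂) ^ H := by
    have := abs_mu_le_mul_rpow hH0 hH1 hx.le h₁ h₂
    have : 0 < (u₁ * u₂) ^ H := by positivity
    linarith
  have hB := abs_mu_le_decay hH0 hH1 hx h₁ h₂
  calc |mu H x u₁ u₂| = |mu H x u₁ u₂| ^ (1 - θ) * |mu H x u₁ u₂| ^ θ := by
        rw [← Real.rpow_add_of_nonneg (abs_nonneg _) (by linarith) hθ0]
        simp
    _ ≤ (8 * (u₁ * u₂) ^ H) ^ (1 - θ) * (8 * ((u₁ * u₂) * x ^ (2*H - 2))) ^ θ := by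
        gcongr
    _ = _ := by
        generalize u₁ * u₂ = w at hu
        rw [Real.mul_rpow (by norm_num) (by positivity), Real.mul_rpow (by norm_num) (by positivity),
          Real.mul_rpow hu.le (by positivity), ← Real.rpow_mul hu.le, ← Real.rpow_mul hx.le,
          show H + θ * (1 - H) = H * (1 - θ) + θ by ring, Real.rpow_add hu,
          show -(θ * (2 - 2*H)) = (2*H - 2) * θ by ring]
        have : (8:ℝ) = 8 ^ (1 - θ) * 8 ^ θ := by
          rw [← Real.rpow_add (by norm_num)]
          simp
        nth_rewrite 3 [this]
        ring

lemma integrableOn_weight {H a c : ℝ} (ha : 0 ≤ a) (hc : c ≤ 0)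
    (hac : 2*H*c + a < -1) :
    IntegrableOn (fun u : ℝ => (1 + u ^ (2*H)) ^ c * u ^ a) (Ioi 0) := by
  have hm : Measurable (fun u : ℝ => (1 + u ^ (2*H)) ^ c * u ^ a) := by fun_prop
  rw [← Ioc_union_Ioi_eq_Ioi zero_le_one]
  refine IntegrableOn.union ?_ ?_
  · refine Measure.integrableOn_of_bounded (M := 1) (by simp) hm.aestronglyMeasurable ?_
    filter_upwards [ae_restrict_mem measurableSet_Ioc] with u hu
    have hp : 0 ≤ u ^ (2*H) := Real.rpow_nonneg hu.1.le _
    rw [Real.norm_of_nonneg (mul_nonneg (by positivity) (Real.rpow_nonneg hu.1.le _))]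
    exact mul_le_one₀ (Real.rpow_le_one_of_one_le_of_nonpos (by linarith) hc)
      (Real.rpow_nonneg hu.1.le _) (Real.rpow_le_one hu.1.le hu.2 ha)
  · refine (integrableOn_Ioi_rpow_of_lt hac one_pos).mono' hm.aestronglyMeasurable ?_
    filter_upwards [ae_restrict_mem measurableSet_Ioi] with u hu
    have hu0 : 0 < u := one_pos.trans hu
    have hp : 0 < u ^ (2*H) := Real.rpow_pos_of_pos hu0 _
    rw [Real.norm_of_nonneg (by positivity), Real.rpow_add hu0, Real.rpow_mul hu0.le (2*H) c]
    gcongr ?_ * _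
    exact Real.rpow_le_rpow_of_nonpos hp (by linarith) hc

lemma abs_G_le {H x u₁ u₂ θ : ℝ} (q : ℕ) (hH0 : 1/2 < H) (hH1 : H < 1) (hx : 0 < x) (h₁ : 0 < u₁)
    (h₂ : 0 < u₂) (hθ0 : 0 ≤ θ) (hθ1 : θ ≤ 1) :
    |G H q 1 x u₁ u₂| ≤ (8 ^ (2*q - 1) * x ^ (-(θ * (2 - 2*H)) * (2*q - 1 : ℕ))) *
      (((1 + u₁ ^ (2*H)) ^ (-(1/2 : ℝ) - (q : ℝ)) * u₁ ^ ((H + θ * (1 - H)) * (2*q - 1 : ℕ))) *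
        ((1 + u₂ ^ (2*H)) ^ (-(1/2 : ℝ) - (q : ℝ)) *
          u₂ ^ ((H + θ * (1 - H)) * (2*q - 1 : ℕ)))) := by
  have hm := pow_le_pow_left₀ (abs_nonneg _)
    (abs_mu_le_interp hH0 hH1 hx h₁ h₂ hθ0 hθ1) (2*q - 1)
  rw [mul_pow, mul_pow, ← Real.rpow_mul_natCast (by positivity),
    ← Real.rpow_mul_natCast hx.le, Real.mul_rpow h₁.le h₂.le] at hm
  rw [G, abs_mul, abs_pow, abs_of_pos (by positivity)]
  refine (mul_le_mul_of_nonneg_left hm (by positivity)).trans_eq ?_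
  ring

lemma measurable_G (H : ℝ) (q : ℕ) (ε : ℝ) :
    Measurable (fun p : ℝ × ℝ × ℝ => G H q ε p.1 p.2.1 p.2.2) := by
  unfold G mu
  fun_prop

lemma integrableOn_G_prod {H θ : ℝ} (q : ℕ) {X : Set ℝ} (hX : MeasurableSet X) (hX0 : X ⊆ Ioi 0)
    (hH0 : 1/2 < H) (hH1 : H < 1) (hθ0 : 0 ≤ θ) (hθ1 : θ ≤ 1)
    (hθ : 2*H*(-(1/2 : ℝ) - (q : ℝ)) + (H + θ * (1 - H)) * (2*q - 1 : ℕ) < -1)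
    (hXi : IntegrableOn (fun x : ℝ => x ^ (-(θ * (2 - 2*H)) * (2*q - 1 : ℕ))) X) :
    IntegrableOn (fun p : ℝ × ℝ × ℝ => G H q 1 p.1 p.2.1 p.2.2)
      (X ×ˢ Ioi (0:ℝ) ×ˢ Ioi (0:ℝ)) volume := by
  have hw := integrableOn_weight (H := H)
    (mul_nonneg (by nlinarith) (Nat.cast_nonneg (2*q - 1)))
    (by have := Nat.cast_nonneg (α := ℝ) q; linarith) hθ
  have hi := (hXi.const_mul (8 ^ (2*q - 1))).mul_prod (hw.mul_prod hw)
  simp only [Measure.prod_restrict] at hi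
  refine hi.mono' (measurable_G H q 1).aestronglyMeasurable ?_
  filter_upwards [ae_restrict_mem (hX.prod (measurableSet_Ioi.prod measurableSet_Ioi))]
    with p ⟨hx, h₁, h₂⟩
  exact abs_G_le q hH0 hH1 (hX0 hx) h₁ h₂ hθ0 hθ1

lemma integrableOn_G {q : ℕ} (hq : 2 ≤ q) {H : ℝ}
    (hH : H ∈ Ioo (3/4 : ℝ) ((4*(q:ℝ) - 3) / (4*(q:ℝ) - 2))) :
    IntegrableOn (fun p : ℝ × ℝ × ℝ => G H q 1 p.1 p.2.1 p.2.2)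
      (Ioi (0:ℝ) ×ˢ Ioi (0:ℝ) ×ˢ Ioi (0:ℝ)) volume := by
  obtain ⟨hH0, hHq⟩ := hH
  have hq' : (2:ℝ) ≤ q := by exact_mod_cast hq
  rw [lt_div_iff₀ (by linarith)] at hHq
  have hH1 : H < 1 := by nlinarith
  have hcast : ((2*q - 1 : ℕ) : ℝ) = 2*q - 1 := by
    rw [Nat.cast_sub (by omega)]
    simp
  have hpos : 0 < (2 - 2*H) * (2*(q:ℝ) - 1) := mul_pos (by linarith) (by linarith)
  rw [← Ioc_union_Ioi_eq_Ioi (zero_le_one (α := ℝ)), union_prod,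
    Ioc_union_Ioi_eq_Ioi (zero_le_one (α := ℝ))]
  refine IntegrableOn.union ?_ ?_
  · refine integrableOn_G_prod (θ := 0) q measurableSet_Ioc (fun x hx => hx.1) (by linarith) hH1
      le_rfl zero_le_one ?_ (by simp)
    rw [hcast]
    linarith
  · obtain ⟨θ, h1, h2⟩ : ∃ θ, 1 / ((2 - 2*H) * (2*(q:ℝ) - 1)) < θ ∧
        θ < min 1 ((4*H - 2) / ((2 - 2*H) * (2*(q:ℝ) - 1))) := by
      refine exists_between (lt_min ?_ ?_)
      · rw [div_lt_one hpos]
        linarith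
      · gcongr
        linarith
    obtain ⟨h2, h3⟩ := lt_min_iff.1 h2
    rw [div_lt_iff₀ hpos] at h1
    rw [lt_div_iff₀ hpos] at h3
    refine integrableOn_G_prod (θ := θ) q measurableSet_Ioi
      (fun x hx => one_pos.trans (show 1 < x from hx)) (by linarith) hH1
      (by by_contra! h; nlinarith) h2.le ?_ (integrableOn_Ioi_rpow_of_lt ?_ one_pos)
    · rw [hcast]
      linarith
    · rw [hcast]
      linarith

lemma G_scale {H : ℝ} {q : ℕ} (hq : 1 ≤ q) {l x u₁ u₂ : ℝ} (hl : 0 < l) (hx : 0 ≤ x)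
    (h₁ : 0 ≤ u₁) (h₂ : 0 ≤ u₂) :
    G H q (l ^ (2*H)) (l * x) (l * u₁) (l * u₂) = (l ^ (2*H)) ^ (-2 : ℝ) * G H q 1 x u₁ u₂ := by
  have hmu : mu H (l * x) (l * u₁) (l * u₂) = l ^ (2*H) * mu H x u₁ u₂ := by
    rw [mu, mu, ← mul_add, ← mul_sub, ← mul_sub, abs_mul, abs_mul, abs_of_pos hl,
      Real.mul_rpow hl.le (by positivity), Real.mul_rpow hl.le hx,
      Real.mul_rpow hl.le (abs_nonneg _), Real.mul_rpow hl.le (abs_nonneg _)]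
    ring
  have hw : ∀ u, 0 ≤ u → (l ^ (2*H) + (l * u) ^ (2*H)) ^ (-(1/2 : ℝ) - (q : ℝ)) =
      (l ^ (2*H)) ^ (-(1/2 : ℝ) - (q : ℝ)) * (1 + u ^ (2*H)) ^ (-(1/2 : ℝ) - (q : ℝ)) := by
    intro u hu
    rw [Real.mul_rpow hl.le hu, ← mul_one_add, Real.mul_rpow (by positivity) (by positivity)]
  have he : 0 < l ^ (2*H) := by positivity
  rw [G, G, hmu, hw _ h₁, hw _ h₂, mul_pow, ← Real.rpow_natCast (l ^ (2*H)),
    show (-2 : ℝ) = (-(1/2 : ℝ) - (q : ℝ)) + (-(1/2 : ℝ) - (q : ℝ)) + (2*q - 1 : ℕ) by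
      rw [Nat.cast_sub (by omega)]; push_cast; ring,
    Real.rpow_add he, Real.rpow_add he]
  ring

lemma measurePreserving_shear :
    MeasurePreserving (fun p : ℝ × ℝ × ℝ × ℝ =>
      (p.1, p.1 + p.2.1, p.1 + p.2.2.1, p.1 + p.2.1 + p.2.2.2)) volume volume := by
  refine (MeasurePreserving.id volume).skew_product (μc := volume) (μd := volume)
    (g := fun s (y : ℝ × ℝ × ℝ) => (s + y.1, s + y.2.1, s + y.1 + y.2.2)) ?_
    (ae_of_all _ fun s => ?_)
  · unfold Function.uncurry
    fun_prop
  · refine ((measurePreserving_add_left volume s).skew_product (μc := volume) (μd := volume)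
      (g := fun x (u : ℝ × ℝ) => (s + u.1, s + x + u.2)) ?_ (ae_of_all _ fun x => ?_)).map_eq
    · unfold Function.uncurry
      fun_prop
    · exact ((measurePreserving_add_left volume s).prod
        (measurePreserving_add_left volume (s + x))).map_eq

lemma integral_shear_smul {F : ℝ × ℝ × ℝ × ℝ → ℝ} (hF : Measurable F) {l : ℝ} (hl : 0 < l) :
    ∫ p, F p = l ^ 3 * ∫ p : ℝ × ℝ × ℝ × ℝ,
      F (p.1, p.1 + l * p.2.1, p.1 + l * p.2.2.1, p.1 + l * p.2.1 + l * p.2.2.2) := by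
  let K : ℝ × ℝ × ℝ × ℝ → ℝ :=
    fun p => F (p.1, p.1 + p.2.1, p.1 + p.2.2.1, p.1 + p.2.1 + p.2.2.2)
  have hK : Measurable K := by fun_prop
  have h1 : ∫ p, F p = ∫ p, K p := by
    conv_lhs => rw [← measurePreserving_shear.map_eq]
    exact integral_map measurePreserving_shear.measurable.aemeasurable hF.aestronglyMeasurable
  have : (volume : Measure (ℝ × ℝ × ℝ)).IsAddHaarMeasure :=
    Measure.prod.instIsAddHaarMeasure _ _
  have hmap : Measure.map (Prod.map id (fun y : ℝ × ℝ × ℝ => l • y)) volume =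
      ENNReal.ofReal (l ^ 3)⁻¹ • (volume : Measure (ℝ × ℝ × ℝ × ℝ)) := by
    rw [Measure.volume_eq_prod, ← Measure.map_prod_map _ _ measurable_id (by fun_prop),
      Measure.map_id, Measure.map_addHaar_smul volume hl.ne', Measure.prod_smul_right]
    congr 2
    simp [abs_of_pos hl]
  have h2 : ∫ p, K (Prod.map id (fun y : ℝ × ℝ × ℝ => l • y) p) = (l ^ 3)⁻¹ * ∫ p, K p := by
    rw [← integral_map (by fun_prop) hK.aestronglyMeasurable, hmap, integral_smul_measure,
      ENNReal.toReal_ofReal (by positivity), smul_eq_mul]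
  rw [h1, show (∫ p, K p) = l ^ 3 * ((l ^ 3)⁻¹ * ∫ p, K p) by field_simp, ← h2]
  rfl

/-- The domain of integration after recentring and rescaling by the factor `l`. -/
def rescaledRegS (T l : ℝ) : Set (ℝ × ℝ × ℝ × ℝ) :=
  {p | (p.1, p.1 + l * p.2.1, p.1 + l * p.2.2.1, p.1 + l * p.2.1 + l * p.2.2.2) ∈ regS T}

lemma measurableSet_rescaledRegS (T l : ℝ) : MeasurableSet (rescaledRegS T l) :=
  measurableSet_preimage (by fun_prop) (measurableSet_regS T)

lemma mem_rescaledRegS {T l : ℝ} (hl : 0 < l) {p : ℝ × ℝ × ℝ × ℝ} :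
    p ∈ rescaledRegS T l ↔ p ∈ Icc 0 T ×ˢ Ici (0:ℝ) ×ˢ Ici (0:ℝ) ×ˢ Ici (0:ℝ) ∧
      p.1 + l * p.2.2.1 ≤ T ∧ p.1 + l * p.2.1 + l * p.2.2.2 ≤ T := by
  obtain ⟨s, x, u, v⟩ := p
  simp only [rescaledRegS, regS, Set.mem_ofPred_eq, mem_prod, mem_Icc, mem_Ici, le_add_iff_nonneg_right,
    mul_nonneg_iff_of_pos_left hl]
  constructor
  · rintro ⟨⟨h1, h2⟩, h3, h4, h5, h6, h7, h8⟩
    exact ⟨⟨⟨h1, h2⟩, h8, h6, h7⟩, h4.2, h5.2⟩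
  · rintro ⟨⟨⟨h1, h2⟩, h3, h4, h5⟩, h6, h7⟩
    have := mul_nonneg hl.le h3
    have := mul_nonneg hl.le h4
    have := mul_nonneg hl.le h5
    exact ⟨⟨h1, h2⟩, ⟨by linarith, by linarith⟩, ⟨by linarith, h6⟩, ⟨by linarith, h7⟩, h4, h5, h3⟩

lemma indicator_regS_shear {H T l : ℝ} {q : ℕ} (hq : 1 ≤ q) (hl : 0 < l) (p : ℝ × ℝ × ℝ × ℝ) :
    (regS T).indicator
        (fun p => G H q (l ^ (2*H)) (p.2.1 - p.1) (p.2.2.1 - p.1) (p.2.2.2 - p.2.1))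
        (p.1, p.1 + l * p.2.1, p.1 + l * p.2.2.1, p.1 + l * p.2.1 + l * p.2.2.2) =
      (l ^ (2*H)) ^ (-2 : ℝ) *
        (rescaledRegS T l).indicator (fun p => G H q 1 p.2.1 p.2.2.1 p.2.2.2) p := by
  by_cases hp : p ∈ rescaledRegS T l
  · obtain ⟨⟨-, hx, h₁, h₂⟩, -⟩ := (mem_rescaledRegS hl).1 hp
    rw [indicator_of_mem hp, indicator_of_mem (show _ ∈ regS T from hp)]
    simp only [add_sub_cancel_left]
    exact G_scale hq hl hx h₁ h₂
  · rw [indicator_of_notMem hp, indicator_of_notMem (show _ ∉ regS T from hp), mul_zero]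

lemma rpow_mul_setIntegral_regS {H : ℝ} (hH : 0 < H) (T : ℝ) {q : ℕ} (hq : 1 ≤ q) {ε : ℝ}
    (hε : 0 < ε) :
    ε ^ (2 - 3/(2*H)) *
        ∫ p in regS T, G H q ε (p.2.1 - p.1) (p.2.2.1 - p.1) (p.2.2.2 - p.2.1) =
      ∫ p, (rescaledRegS T (ε ^ (1/(2*H)))).indicator
        (fun p => G H q 1 p.2.1 p.2.2.1 p.2.2.2) p := by
  have hl : 0 < ε ^ (1/(2*H)) := by positivity
  have hlε : (ε ^ (1/(2*H))) ^ (2*H) = ε := by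
    rw [← Real.rpow_mul hε.le, one_div_mul_cancel (by positivity), Real.rpow_one]
  have hl3 : (ε ^ (1/(2*H))) ^ 3 = ε ^ (3/(2*H)) := by
    rw [← Real.rpow_mul_natCast hε.le]
    congr 1
    push_cast
    ring
  have hmeas : Measurable (fun p : ℝ × ℝ × ℝ × ℝ =>
      G H q ε (p.2.1 - p.1) (p.2.2.1 - p.1) (p.2.2.2 - p.2.1)) := by
    unfold G mu
    fun_prop
  rw [← integral_indicator (measurableSet_regS T),
    integral_shear_smul (hmeas.indicator (measurableSet_regS T)) hl, hl3]
  generalize ε ^ (1/(2*H)) = l at hl hlε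
  rw [← hlε]
  simp_rw [indicator_regS_shear hq hl]
  rw [hlε, integral_const_mul, ← mul_assoc, ← mul_assoc, ← Real.rpow_add hε, ← Real.rpow_add hε,
    show 2 - 3/(2*H) + 3/(2*H) + -2 = 0 by ring, Real.rpow_zero, one_mul]

lemma Ici_prod_ae_eq_Ioi_prod :
    (Ici (0:ℝ) ×ˢ Ici (0:ℝ) ×ˢ Ici (0:ℝ) : Set (ℝ × ℝ × ℝ)) =ᵐ[volume]
      (Ioi (0:ℝ) ×ˢ Ioi (0:ℝ) ×ˢ Ioi (0:ℝ) : Set (ℝ × ℝ × ℝ)) :=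
  Measure.set_prod_ae_eq Ioi_ae_eq_Ici.symm
    (Measure.set_prod_ae_eq Ioi_ae_eq_Ici.symm Ioi_ae_eq_Ici.symm)

lemma tendsto_indicator_rescaledRegS {T : ℝ} {p : ℝ × ℝ × ℝ × ℝ} (hp : p.1 ≠ T)
    (g : ℝ × ℝ × ℝ × ℝ → ℝ) {α : Type*} {f : Filter α} {l : α → ℝ}
    (hl0 : ∀ᶠ a in f, 0 < l a) (hl : Tendsto l f (nhds 0)) :
    Tendsto (fun a => (rescaledRegS T (l a)).indicator g p) f
      (nhds ((Icc 0 T ×ˢ Ici (0:ℝ) ×ˢ Ici (0:ℝ) ×ˢ Ici (0:ℝ)).indicator g p)) := by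
  refine tendsto_const_nhds.congr' ?_
  by_cases h : p ∈ Icc 0 T ×ˢ Ici (0:ℝ) ×ˢ Ici (0:ℝ) ×ˢ Ici (0:ℝ)
  · have hpT : p.1 < T := h.1.2.lt_of_ne hp
    have h1 : Tendsto (fun a => p.1 + l a * p.2.2.1) f (nhds p.1) := by
      simpa using (hl.mul_const p.2.2.1).const_add p.1
    have h2 : Tendsto (fun a => p.1 + l a * p.2.1 + l a * p.2.2.2) f (nhds p.1) := by
      simpa using ((hl.mul_const p.2.1).const_add p.1).add (hl.mul_const p.2.2.2)
    filter_upwards [hl0, h1.eventually_le_const hpT, h2.eventually_le_const hpT] with a h0 h1 h2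
    rw [indicator_of_mem h, indicator_of_mem ((mem_rescaledRegS h0).2 ⟨h, h1, h2⟩)]
  · filter_upwards [hl0] with a h0
    rw [indicator_of_notMem h, indicator_of_notMem fun h' => h ((mem_rescaledRegS h0).1 h').1]

/-- For `q ≥ 2` and `3/4 < H < (4q-3)/(4q-2)`, the constant
`σ_q² = 2(2q-1)! β_q² T ∫_{ℝ₊³} G^{(q)}_{1,x}(u₁,u₂)` is finite and
`ε^{2 - 3/(2H)} E_q(ε) → σ_q²` as `ε → 0⁺`. -/
theorem tendsto_variance_chaos_high (T : ℝ) (hT : 0 < T) (q : ℕ) (hq : 2 ≤ q) (H : ℝ)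
    (hH : H ∈ Ioo (3/4 : ℝ) ((4*(q:ℝ) - 3) / (4*(q:ℝ) - 2))) :
    IntegrableOn (fun p : ℝ × ℝ × ℝ => G H q 1 p.1 p.2.1 p.2.2)
      (Ioi (0:ℝ) ×ˢ Ioi (0:ℝ) ×ˢ Ioi (0:ℝ)) volume ∧
    Tendsto (fun ε : ℝ => ε ^ (2 - 3/(2*H)) * Evar H T q ε) (nhdsWithin 0 (Ioi 0))
      (nhds (2 * (Nat.factorial (2*q - 1)) * betaConst q ^ 2 * T *
        ∫ p in Ioi (0:ℝ) ×ˢ Ioi (0:ℝ) ×ˢ Ioi (0:ℝ), G H q 1 p.1 p.2.1 p.2.2)) := by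
  have hGi := integrableOn_G hq hH
  refine ⟨hGi, ?_⟩
  have hH0 : 0 < H := by linarith [hH.1]
  have hGi' := hGi.congr_set_ae Ici_prod_ae_eq_Ioi_prod
  have hbound : IntegrableOn (fun p : ℝ × ℝ × ℝ × ℝ => G H q 1 p.2.1 p.2.2.1 p.2.2.2)
      (Icc 0 T ×ˢ Ici (0:ℝ) ×ˢ Ici (0:ℝ) ×ˢ Ici (0:ℝ)) := by
    have h1 : IntegrableOn (fun _ : ℝ => (1:ℝ)) (Icc 0 T) := by simp
    have := h1.mul_prod hGi'
    rw [Measure.prod_restrict] at this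
    simp only [one_mul] at this
    exact this
  have hset : MeasurableSet (Icc 0 T ×ˢ Ici (0:ℝ) ×ˢ Ici (0:ℝ) ×ˢ Ici (0:ℝ)) :=
    measurableSet_Icc.prod (measurableSet_Ici.prod (measurableSet_Ici.prod measurableSet_Ici))
  have hlim : ∫ p, (Icc 0 T ×ˢ Ici (0:ℝ) ×ˢ Ici (0:ℝ) ×ˢ Ici (0:ℝ)).indicator
      (fun p : ℝ × ℝ × ℝ × ℝ => G H q 1 p.2.1 p.2.2.1 p.2.2.2) p =
      T * ∫ p in Ioi (0:ℝ) ×ˢ Ioi (0:ℝ) ×ˢ Ioi (0:ℝ), G H q 1 p.1 p.2.1 p.2.2 := by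
    have h := setIntegral_prod_mul (μ := (volume : Measure ℝ))
      (ν := (volume : Measure (ℝ × ℝ × ℝ))) (fun _ => (1:ℝ))
      (fun p : ℝ × ℝ × ℝ => G H q 1 p.1 p.2.1 p.2.2) (Icc 0 T)
      (Ici (0:ℝ) ×ˢ Ici (0:ℝ) ×ˢ Ici (0:ℝ))
    rw [integral_indicator hset, ← setIntegral_congr_set Ici_prod_ae_eq_Ioi_prod]
    simp only [one_mul] at h
    refine h.trans ?_
    simp [hT.le]
  have hae : ∀ᵐ p : ℝ × ℝ × ℝ × ℝ, p.1 ≠ T :=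
    Measure.quasiMeasurePreserving_fst.ae (Measure.ae_ne volume T)
  have hpos : ∀ᶠ ε : ℝ in nhdsWithin 0 (Ioi 0), 0 < ε ^ (1/(2*H)) := by
    filter_upwards [self_mem_nhdsWithin] with ε hε
    exact Real.rpow_pos_of_pos hε _
  have hto : Tendsto (fun ε : ℝ => ε ^ (1/(2*H))) (nhdsWithin 0 (Ioi 0)) (nhds 0) := by
    have := (Real.continuousAt_rpow_const 0 (1/(2*H)) (Or.inr (by positivity))).tendsto
    rw [Real.zero_rpow (by positivity)] at this
    exact this.mono_left nhdsWithin_le_nhds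
  have hmain : Tendsto (fun ε : ℝ => ∫ p, (rescaledRegS T (ε ^ (1/(2*H)))).indicator
      (fun p => G H q 1 p.2.1 p.2.2.1 p.2.2.2) p) (nhdsWithin 0 (Ioi 0))
      (nhds (T * ∫ p in Ioi (0:ℝ) ×ˢ Ioi (0:ℝ) ×ˢ Ioi (0:ℝ), G H q 1 p.1 p.2.1 p.2.2)) := by
    rw [← hlim]
    refine tendsto_integral_filter_of_dominated_convergence _ ?_ ?_
      (hbound.integrable_indicator hset).norm ?_
    · exact Eventually.of_forall fun ε => (((measurable_G H q 1).comp measurable_snd).indicator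
        (measurableSet_rescaledRegS T _)).aestronglyMeasurable
    · filter_upwards [hpos] with ε hε
      refine ae_of_all _ fun p => ?_
      exact norm_indicator_le_of_subset (fun p hp => ((mem_rescaledRegS hε).1 hp).1) _ p
    · filter_upwards [hae] with p hp
      exact tendsto_indicator_rescaledRegS hp _ hpos hto
  rw [mul_assoc _ T]
  refine (hmain.const_mul _).congr' ?_
  filter_upwards [self_mem_nhdsWithin] with ε hε
  rw [← rpow_mul_setIntegral_regS hH0 T (by omega) hε, Evar]
  ring
end
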